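/- Let Φ be a Young function satisfying the Δ2-condition. Every sequence (ξ_n) in L_{Φ*} with sup_n ‖ξ_n‖_{Φ*} < ∞ admits a subsequence (ξ_{n_k}) and a ξ ∈ L_{Φ*} such that for every further subsequence (ξ_{n_{k(i)}}), the sequence of Cesàro means (1/N) Σ_{i≤N} ξ_{n_{k(i)}} has a subsequence converging in order to ξ: there is a strictly increasing sequence (N_l) with sup_l |(1/N_l) Σ_{i≤N_l} ξ_{n_{k(i)}}| ∈ L_{Φ*} and (1/N_l) Σ_{i≤N_l} ξ_{n_{k(i)}} → ξ a.s. -/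

import Mathlib

open MeasureTheory Filter Topology Set
open scoped ENNReal

noncomputable section

namespace OrliczPaper

variable {Ω : Type*} [MeasurableSpace Ω]

/-- A (finite, coercive) Young function: an even convex function with `Φ 0 = 0`
and `Φ x / x → ∞` as `x → ∞`. -/
structure IsYoung (Φ : ℝ → ℝ) : Prop where
  even : ∀ x, Φ (-x) = Φ x
  convexOn : ConvexOn ℝ Set.univ Φ
  map_zero : Φ 0 = 0
  coercive : Tendsto (fun x => Φ x / x) atTop atTop

/-- The Δ₂-condition: `limsup_{x→∞} Φ(2x)/Φ(x) < ∞`, i.e. `Φ(2x) ≤ C Φ(x)`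
for all large `x`. -/
def Delta2 (Φ : ℝ → ℝ) : Prop :=
  ∃ C x₀ : ℝ, ∀ x ≥ x₀, Φ (2 * x) ≤ C * Φ x

/-- The conjugate Young function `Φ*(y) = sup_x (x y − Φ x)`. -/
def conj (Φ : ℝ → ℝ) (y : ℝ) : ℝ := ⨆ x : ℝ, x * y - Φ x

variable (P : Measure Ω)

/-- Membership in the Orlicz space `L_Φ`: a measurable function with
`E[Φ(l ξ)] < ∞` for some `l > 0`. -/
def MemOrlicz (Φ : ℝ → ℝ) (f : Ω → ℝ) : Prop :=
  Measurable f ∧ ∃ l : ℝ, 0 < l ∧ ∫⁻ ω, ENNReal.ofReal (Φ (l * f ω)) ∂P < ⊤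

/-- The Orlicz space `L_Φ`, as a set of (everywhere defined) measurable functions. -/
def Orlicz (Φ : ℝ → ℝ) : Set (Ω → ℝ) := {f | MemOrlicz P Φ f}

/-- The Luxemburg norm `‖f‖_Φ = inf {l > 0 : E[Φ(f/l)] ≤ 1}`. -/
def luxNorm (Φ : ℝ → ℝ) (f : Ω → ℝ) : ℝ :=
  sInf {l : ℝ | 0 < l ∧ ∫⁻ ω, ENNReal.ofReal (Φ (f ω / l)) ∂P ≤ 1}

/-- The Orlicz (dual) norm `‖f‖_{(Φ*)} = sup {E[g f] : E[Φ(g)] ≤ 1}`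
(the Young function `Φ` here is the one of the *predual*). -/
def orliczNorm (Φ : ℝ → ℝ) (f : Ω → ℝ) : ℝ :=
  sSup {r : ℝ | ∃ g : Ω → ℝ, Measurable g ∧
    (∫⁻ ω, ENNReal.ofReal (Φ (g ω)) ∂P) ≤ 1 ∧ r = ∫ ω, g ω * f ω ∂P}

/-- The bilinear pairing `⟨f, g⟩ = E[f g]`. -/
def pairing (f g : Ω → ℝ) : ℝ := ∫ ω, f ω * g ω ∂P

/-- The weak topology `σ(E, F)` on `E` induced by the pairing with `F`. -/
def weakT (E F : Set (Ω → ℝ)) : TopologicalSpace E :=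
  TopologicalSpace.induced
    (fun ξ : E => fun η : F => pairing P (ξ : Ω → ℝ) (η : Ω → ℝ)) inferInstance

/-- The absolutely convex (convex and balanced) `σ(F,E)`-compact subsets of `F`. -/
def dualSets (E F : Set (Ω → ℝ)) : Set (Set F) :=
  {A | Convex ℝ (Subtype.val '' A) ∧ Balanced ℝ (Subtype.val '' A) ∧
    @IsCompact _ (weakT P F E) A}

/-- The Mackey topology `τ(E, F)`: the topology on `E` of uniform convergence on
absolutely convex `σ(F,E)`-compact subsets of `F`. -/
def mackeyT (E F : Set (Ω → ℝ)) : TopologicalSpace E :=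
  TopologicalSpace.induced
    (fun ξ : E => UniformOnFun.ofFun (dualSets P E F)
      (fun η : F => pairing P (ξ : Ω → ℝ) (η : Ω → ℝ)))
    inferInstance

/-- A distance generating the topology of convergence in `P`-probability. -/
def probDist (f g : Ω → ℝ) : ℝ := ∫ ω, min |f ω - g ω| 1 ∂P

/-- The topology of convergence in probability, restricted to `E ⊆ L₀`. -/
def probT (E : Set (Ω → ℝ)) : TopologicalSpace E :=
  TopologicalSpace.generateFrom
    {U | ∃ f : E, ∃ ε : ℝ, 0 < ε ∧ U = {g : E | probDist P (f : Ω → ℝ) (g : Ω → ℝ) < ε}}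

/-- `L_∞`: essentially bounded measurable functions. -/
def Linf : Set (Ω → ℝ) := {f | Measurable f ∧ ∃ C : ℝ, ∀ᵐ ω ∂P, |f ω| ≤ C}

/-- `L_1`: integrable measurable functions. -/
def L1 : Set (Ω → ℝ) := {f | Measurable f ∧ Integrable f P}

/-- The essential supremum norm. -/
def linfNorm (f : Ω → ℝ) : ℝ := sInf {C : ℝ | 0 ≤ C ∧ ∀ᵐ ω ∂P, |f ω| ≤ C}

/-- Uniform integrability of a set of functions:
`sup_{f ∈ A} E[|f| 1_{|f| > N}] → 0`. -/
def UnifInt (A : Set (Ω → ℝ)) : Prop :=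
  Tendsto (fun N : ℕ => ⨆ f ∈ A, ∫⁻ ω in {ω | (N : ℝ) < |f ω|}, ENNReal.ofReal |f ω| ∂P)
    atTop (𝓝 0)

/-- Uniform integrability of a sequence of functions. -/
def UnifIntSeq (g : ℕ → Ω → ℝ) : Prop :=
  Tendsto (fun N : ℕ => ⨆ n, ∫⁻ ω in {ω | (N : ℝ) < |g n ω|}, ENNReal.ofReal |g n ω| ∂P)
    atTop (𝓝 0)

/-- The Cesàro means of a sequence of functions: `cesaro ξ N` is the average of
`ξ 0, …, ξ N`. -/
def cesaro (ξ : ℕ → Ω → ℝ) (N : ℕ) : Ω → ℝ :=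
  fun ω => (∑ i ∈ Finset.range (N + 1), ξ i ω) / (N + 1)

/-- `sup_n |ξ n| ∈ L_Φ` (order boundedness of the sequence `ξ` in `L_Φ`). -/
def supMem (Φ : ℝ → ℝ) (ξ : ℕ → Ω → ℝ) : Prop :=
  (∀ᵐ ω ∂P, BddAbove (Set.range fun n => |ξ n ω|)) ∧
    MemOrlicz P Φ (fun ω => ⨆ n, |ξ n ω|)

/-- `ξb` is a sequence of forward convex combinations of `ξ`:
`ξb n ∈ conv (ξ k ; k ≥ n)`. -/
def FwdConvComb (ξ ξb : ℕ → Ω → ℝ) : Prop :=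
  ∀ n, ξb n ∈ convexHull ℝ {g : Ω → ℝ | ∃ k ≥ n, g = ξ k}

/-- The left derivative of a convex function. -/
def leftDeriv (Φ : ℝ → ℝ) (y : ℝ) : ℝ :=
  ⨆ h : {h : ℝ // 0 < h}, (Φ y - Φ (y - (h : ℝ))) / (h : ℝ)

/-- `p_Φ(x) = sup_{y > x} y Φ'(y) / Φ(y)`. -/
def pPhiAt (Φ : ℝ → ℝ) (x : ℝ) : ℝ≥0∞ :=
  ⨆ y : {y : ℝ // x < y}, ENNReal.ofReal ((y : ℝ) * leftDeriv Φ (y : ℝ) / Φ (y : ℝ))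

/-- `p_Φ = inf_{x ≥ 0} p_Φ(x)`. -/
def pPhi (Φ : ℝ → ℝ) : ℝ≥0∞ := ⨅ x : {x : ℝ // 0 ≤ x}, pPhiAt Φ x

/-- `q_Φ = p_Φ / (p_Φ − 1)` (with `1/0 = ∞`). -/
def qPhi (Φ : ℝ → ℝ) : ℝ≥0∞ := pPhi Φ / (pPhi Φ - 1)

end OrliczPaper

namespace OrliczPaper

/-- A finite even convex function dominating `|·|` whose growth at infinity is controlled from
below in the sense of `∇₂`: `K G(y / K)` is negligible compared with `G y` for large `K`, `y`. -/
structure IsGauge (G : ℝ → ℝ) : Prop where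
  even : ∀ x, G (-x) = G x
  convexOn : ConvexOn ℝ univ G
  map_zero : G 0 = 0
  abs_le : ∀ x, |x| ≤ G x
  nabla : ∀ ε : ℝ, 0 < ε → ∃ K y₀ : ℝ, 1 ≤ K ∧ ∀ y, y₀ ≤ |y| → K * G (y / K) ≤ ε * G y

section EvenConvex

variable {G : ℝ → ℝ}

lemma convex_smul_le (hc : ConvexOn ℝ univ G) (h0 : G 0 = 0) {t : ℝ} (ht : 0 ≤ t) (ht1 : t ≤ 1)
    (x : ℝ) : G (t * x) ≤ t * G x := by
  have := hc.2 (mem_univ x) (mem_univ 0) ht (sub_nonneg.2 ht1) (by ring)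
  simpa [h0] using this

lemma even_convex_nonneg (he : ∀ x, G (-x) = G x) (hc : ConvexOn ℝ univ G) (h0 : G 0 = 0)
    (x : ℝ) : 0 ≤ G x := by
  have := hc.2 (mem_univ x) (mem_univ (-x)) (by norm_num : (0 : ℝ) ≤ 1 / 2)
    (by norm_num : (0 : ℝ) ≤ 1 / 2) (by norm_num)
  simp [h0, he] at this
  linarith

lemma even_convex_abs (he : ∀ x, G (-x) = G x) (x : ℝ) : G |x| = G x := by
  rcases abs_choice x with h | h <;> rw [h]
  exact he x

lemma even_convex_mono (he : ∀ x, G (-x) = G x) (hc : ConvexOn ℝ univ G) (h0 : G 0 = 0)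
    {x y : ℝ} (h : |x| ≤ |y|) : G x ≤ G y := by
  rw [← even_convex_abs he x, ← even_convex_abs he y]
  rcases (abs_nonneg y).eq_or_lt with hy | hy
  · rw [← hy] at h ⊢
    rw [le_antisymm h (abs_nonneg x)]
  · have h1 := convex_smul_le hc h0 (div_nonneg (abs_nonneg x) hy.le)
      ((div_le_one hy).2 h) |y|
    rw [div_mul_cancel₀ _ hy.ne'] at h1
    exact h1.trans (mul_le_of_le_one_left (even_convex_nonneg he hc h0 _) ((div_le_one hy).2 h))

end EvenConvex

namespace IsYoung

variable {Φ : ℝ → ℝ}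

lemma nonneg (h : IsYoung Φ) (x : ℝ) : 0 ≤ Φ x :=
  even_convex_nonneg h.even h.convexOn h.map_zero x

lemma bddAbove_conj (h : IsYoung Φ) (y : ℝ) :
    BddAbove (range fun x : ℝ => x * y - Φ x) := by
  obtain ⟨X, hX⟩ := (h.coercive.eventually_ge_atTop |y|).exists_forall_of_atTop
  refine ⟨max X 1 * |y|, ?_⟩
  rintro _ ⟨x, rfl⟩
  have hxy : x * y ≤ |x| * |y| := (le_abs_self _).trans (abs_mul x y).le
  simp only
  rcases le_total |x| (max X 1) with hx | hx
  · have := mul_le_mul_of_nonneg_right hx (abs_nonneg y)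
    linarith [h.nonneg x]
  · have hpos : 0 < |x| := lt_of_lt_of_le (by positivity) hx
    have := hX |x| ((le_max_left _ _).trans hx)
    rw [le_div_iff₀ hpos, even_convex_abs h.even] at this
    have : 0 ≤ max X 1 * |y| := by positivity
    linarith

lemma le_conj (h : IsYoung Φ) (x y : ℝ) : x * y - Φ x ≤ conj Φ y :=
  le_ciSup (h.bddAbove_conj y) x

lemma conj_even (h : IsYoung Φ) (y : ℝ) : conj Φ (-y) = conj Φ y := by
  have key : ∀ z, conj Φ (-z) ≤ conj Φ z := fun z => ciSup_le fun x => by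
    have := h.le_conj (-x) z
    rw [h.even] at this
    linarith
  exact le_antisymm (key y) (by simpa using key (-y))

lemma conj_convexOn (h : IsYoung Φ) : ConvexOn ℝ univ (conj Φ) := by
  refine ⟨convex_univ, fun y _ z _ a b ha hb hab => ciSup_le fun x => ?_⟩
  have h1 := mul_le_mul_of_nonneg_left (h.le_conj x y) ha
  have h2 := mul_le_mul_of_nonneg_left (h.le_conj x z) hb
  have h3 : Φ x = a * Φ x + b * Φ x := by rw [← add_mul, hab, one_mul]
  simp only [smul_eq_mul]
  rw [h3]
  linarith

lemma conj_zero (h : IsYoung Φ) : conj Φ 0 = 0 :=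
  le_antisymm (ciSup_le fun x => by simpa using h.nonneg x)
    (by simpa [h.map_zero] using h.le_conj 0 0)

lemma conj_abs (h : IsYoung Φ) (y : ℝ) : conj Φ |y| = conj Φ y :=
  even_convex_abs h.conj_even y

lemma conj_nonneg (h : IsYoung Φ) (y : ℝ) : 0 ≤ conj Φ y :=
  even_convex_nonneg h.conj_even h.conj_convexOn h.conj_zero y

/-- The `Δ₂`-condition of a Young function implies the `∇₂`-condition of its conjugate. -/
lemma conj_nabla (h : IsYoung Φ) (hΔ : Delta2 Φ) (ε : ℝ) (hε : 0 < ε) :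
    ∃ K y₀ : ℝ, 1 ≤ K ∧ ∀ y, y₀ ≤ |y| → K * conj Φ (y / K) ≤ ε * conj Φ y := by
  obtain ⟨C₀, x₁, hC₀⟩ := hΔ
  set C := max C₀ 2
  set x₀ := max x₁ 0
  have hC2 : 2 ≤ C := le_max_right _ _
  have hx0 : 0 ≤ x₀ := le_max_right _ _
  have hC : ∀ x ≥ x₀, Φ (2 * x) ≤ C * Φ x := fun x hx =>
    (hC₀ x ((le_max_left _ _).trans hx)).trans
      (mul_le_mul_of_nonneg_right (le_max_left _ _) (h.nonneg x))
  have hiter : ∀ (m : ℕ), ∀ x ≥ x₀, Φ (2 ^ m * x) ≤ C ^ m * Φ x := by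
    intro m
    induction m with
    | zero => intro x _; simp
    | succ m ih =>
      intro x hx
      have hx' : 2 ^ m * x ≥ x₀ :=
        hx.le.trans (le_mul_of_one_le_left (hx0.trans hx) (one_le_pow₀ (by norm_num)))
      calc Φ (2 ^ (m + 1) * x) = Φ (2 * (2 ^ m * x)) := by ring_nf
        _ ≤ C * (C ^ m * Φ x) := (hC _ hx').trans
            (mul_le_mul_of_nonneg_left (ih x hx) (by linarith))
        _ = _ := by ring
  obtain ⟨m, hm⟩ := exists_pow_lt_of_lt_one hε (by norm_num : (1 / 2 : ℝ) < 1)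
  have hCm : 0 < C ^ m := by positivity
  set K : ℝ := (C / 2) ^ m with hK
  have hK1 : 1 ≤ K := one_le_pow₀ (by linarith)
  have hK2 : K * 2 ^ m = C ^ m := by rw [hK, ← mul_pow]; congr 1; ring
  refine ⟨K, K * Φ (x₀ + 1), hK1, fun y hy => ?_⟩
  have hKpos : 0 < K := by linarith
  set z := |y| / K with hz
  have hzy : Φ (x₀ + 1) ≤ z := by rw [hz, le_div_iff₀ hKpos]; linarith
  have hz0 : 0 ≤ z := by positivity
  have hlarge : ∀ x ≥ x₀, C ^ m * (x * z - Φ x) ≤ conj Φ |y| := by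
    intro x hx
    have h1 := h.le_conj (2 ^ m * x) |y|
    have h2 := hiter m x hx
    have h3 : |y| = K * z := by rw [hz]; field_simp
    have h4 : 2 ^ m * x * |y| = C ^ m * (x * z) := by rw [h3, ← hK2]; ring
    rw [h4] at h1
    linarith [mul_sub (C ^ m) (x * z) (Φ x)]
  have hall : conj Φ z ≤ conj Φ |y| / C ^ m := by
    refine ciSup_le fun x => ?_
    rw [le_div_iff₀' hCm]
    rcases le_total x₀ x with hx | hx
    · exact hlarge x hx
    · refine le_trans ?_ (hlarge (x₀ + 1) (by simp))
      refine mul_le_mul_of_nonneg_left ?_ hCm.le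
      have := mul_le_mul_of_nonneg_right hx hz0
      have := h.nonneg x
      linarith
  have hyz : conj Φ (y / K) = conj Φ z := by
    rw [← h.conj_abs (y / K), abs_div, abs_of_pos hKpos]
  rw [hyz]
  rw [h.conj_abs] at hall
  calc K * conj Φ z ≤ K * (conj Φ y / C ^ m) := mul_le_mul_of_nonneg_left hall hKpos.le
    _ = (1 / 2) ^ m * conj Φ y := by rw [← hK2, one_div, inv_pow]; field_simp
    _ ≤ ε * conj Φ y := mul_le_mul_of_nonneg_right hm.le (h.conj_nonneg y)

lemma conj_superlinear (h : IsYoung Φ) (t y : ℝ) (hy : Φ (t + 1) ≤ |y|) :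
    t * |y| ≤ conj Φ y := by
  have := h.le_conj (t + 1) |y|
  rw [h.conj_abs] at this
  linarith

/-- The scaled conjugate of a `Δ₂` Young function, plus the absolute value, is a gauge. -/
lemma isGauge_conj (h : IsYoung Φ) (hΔ : Delta2 Φ) {r : ℝ} (hr : 0 < r) :
    IsGauge fun y => conj Φ (y / r) + |y| where
  even x := by rw [neg_div, h.conj_even, abs_neg]
  convexOn := by
    refine ConvexOn.add ?_ (convexOn_univ_norm (E := ℝ))
    refine ⟨convex_univ, fun y _ z _ a b ha hb hab => ?_⟩
    have := h.conj_convexOn.2 (mem_univ (y / r)) (mem_univ (z / r)) ha hb hab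
    simp only [smul_eq_mul] at this ⊢
    convert this using 2
    ring
  map_zero := by simp [h.conj_zero]
  abs_le x := by linarith [h.conj_nonneg (x / r)]
  nabla ε hε := by
    obtain ⟨K, y₀, hK1, hK⟩ := h.conj_nabla hΔ (ε / 2) (by positivity)
    have hKpos : 0 < K := by linarith
    refine ⟨K, max (r * y₀) (r * Φ (2 * r / ε + 1)), hK1, fun y hy => ?_⟩
    have hyr : |y / r| = |y| / r := by rw [abs_div, abs_of_pos hr]
    have h1 := hK (y / r) (by
      rw [hyr, le_div_iff₀' hr]; exact (le_max_left _ _).trans hy)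
    have h2 := h.conj_superlinear (2 * r / ε) (y / r) (by
      rw [hyr, le_div_iff₀' hr]; exact (le_max_right _ _).trans hy)
    rw [hyr] at h2
    have h3 : 2 * r / ε * (|y| / r) = 2 / ε * |y| := by field_simp
    rw [h3, div_mul_eq_mul_div, div_le_iff₀ hε] at h2
    have h4 : K * |y / K| = |y| := by
      rw [abs_div, abs_of_pos hKpos]; field_simp
    have h5 : y / K / r = y / r / K := by ring
    have h6 : 0 ≤ ε * |y| := by positivity
    rw [h5, mul_add, h4]
    linarith

end IsYoung

namespace IsGauge

variable {G : ℝ → ℝ}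

lemma nonneg (h : IsGauge G) (x : ℝ) : 0 ≤ G x := (abs_nonneg x).trans (h.abs_le x)

lemma mono (h : IsGauge G) {x y : ℝ} (hxy : |x| ≤ |y|) : G x ≤ G y :=
  even_convex_mono h.even h.convexOn h.map_zero hxy

lemma continuous (h : IsGauge G) : Continuous G :=
  continuousOn_univ.1 (h.convexOn.continuousOn isOpen_univ)

lemma measurable (h : IsGauge G) : Measurable G := h.continuous.measurable

lemma smul_le (h : IsGauge G) {t : ℝ} (ht : 0 ≤ t) (ht1 : t ≤ 1) (x : ℝ) :
    G (t * x) ≤ t * G x :=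
  convex_smul_le h.convexOn h.map_zero ht ht1 x

lemma half_add_le (h : IsGauge G) (x y : ℝ) : G ((x + y) / 2) ≤ G x + G y := by
  have := h.convexOn.2 (mem_univ x) (mem_univ y) (by norm_num : (0 : ℝ) ≤ 1 / 2)
    (by norm_num : (0 : ℝ) ≤ 1 / 2) (by norm_num)
  simp only [smul_eq_mul] at this
  rw [show (x + y) / 2 = 1 / 2 * x + 1 / 2 * y by ring]
  linarith [h.nonneg x, h.nonneg y]

lemma quarter_add_le (h : IsGauge G) (x y z : ℝ) :
    G ((x + y + z) / 4) ≤ G x + G y + G z := by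
  have h1 := h.half_add_le ((x + y) / 2) (z / 2)
  have h2 := h.half_add_le x y
  have h3 : G (z / 2) ≤ G z := h.mono (by rw [abs_div, abs_two]; linarith [abs_nonneg z])
  rw [show (x + y + z) / 4 = ((x + y) / 2 + z / 2) / 2 by ring]
  linarith

/-- For `N ≥ K`, the bound on `K G (y / K)` passes to `N G (y / N)`. -/
lemma nabla_of_le (h : IsGauge G) {K N y ε : ℝ} (hK : 1 ≤ K) (hN : K ≤ N)
    (hy : K * G (y / K) ≤ ε * G y) : N * G (y / N) ≤ ε * G y := by
  have hKp : 0 < K := by linarith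
  have hNp : 0 < N := by linarith
  have := h.smul_le (div_nonneg hKp.le hNp.le) ((div_le_one hNp).2 hN) (y / K)
  rw [show K / N * (y / K) = y / N by field_simp] at this
  calc N * G (y / N) ≤ N * (K / N * G (y / K)) := mul_le_mul_of_nonneg_left this hNp.le
    _ = K * G (y / K) := by field_simp
    _ ≤ _ := hy

lemma average_le (h : IsGauge G) (x : ℕ → ℝ) (N : ℕ) :
    G ((∑ i ∈ Finset.range (N + 1), x i) / (N + 1)) ≤
      (∑ i ∈ Finset.range (N + 1), G (x i)) / (N + 1) := by
  have hN : (0 : ℝ) < N + 1 := by positivity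
  have := h.convexOn.map_sum_le (t := Finset.range (N + 1)) (w := fun _ => ((N : ℝ) + 1)⁻¹)
    (p := x) (fun _ _ => by positivity) (by simp; field_simp) (fun _ _ => mem_univ _)
  simp only [smul_eq_mul, ← Finset.mul_sum] at this
  rwa [div_eq_inv_mul, div_eq_inv_mul]

end IsGauge

section Modular

variable {Ω : Type*} [MeasurableSpace Ω] {P : Measure Ω} {G : ℝ → ℝ}

/-- The modular `E[G(f)]`. -/
def modular (P : Measure Ω) (G : ℝ → ℝ) (f : Ω → ℝ) : ℝ≥0∞ :=
  ∫⁻ ω, ENNReal.ofReal (G (f ω)) ∂P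

lemma measurable_cesaro {f : ℕ → Ω → ℝ} (hf : ∀ i, Measurable (f i)) (N : ℕ) :
    Measurable (cesaro f N) := by
  unfold cesaro
  fun_prop

lemma lintegral_average_le {u : ℕ → Ω → ℝ} (hu : ∀ i, Measurable (u i))
    (hu0 : ∀ i ω, 0 ≤ u i ω) {v : ℕ → ℝ} (hv0 : ∀ i, 0 ≤ v i)
    (hv : ∀ i, ∫⁻ ω, ENNReal.ofReal (u i ω) ∂P ≤ ENNReal.ofReal (v i)) (N : ℕ) :
    ∫⁻ ω, ENNReal.ofReal ((∑ i ∈ Finset.range (N + 1), u i ω) / (N + 1)) ∂P ≤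
      ENNReal.ofReal ((∑ i ∈ Finset.range (N + 1), v i) / (N + 1)) := by
  have hN : (0 : ℝ) < N + 1 := by positivity
  have h1 : ∀ ω, ENNReal.ofReal ((∑ i ∈ Finset.range (N + 1), u i ω) / (N + 1)) =
      ENNReal.ofReal ((N : ℝ) + 1)⁻¹ * ∑ i ∈ Finset.range (N + 1), ENNReal.ofReal (u i ω) := by
    intro ω
    rw [div_eq_inv_mul, ENNReal.ofReal_mul (by positivity),
      ENNReal.ofReal_sum_of_nonneg fun i _ => hu0 i ω]
  simp_rw [h1]
  rw [lintegral_const_mul _ (Finset.measurable_sum _ fun i _ => (hu i).ennreal_ofReal),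
    lintegral_finsetSum _ fun i _ => (hu i).ennreal_ofReal, div_eq_inv_mul,
    ENNReal.ofReal_mul (by positivity), ENNReal.ofReal_sum_of_nonneg fun i _ => hv0 i]
  gcongr with i _
  exact hv i

lemma tendsto_average {v : ℕ → ℝ} {l : ℝ} (h : Tendsto v atTop (𝓝 l)) :
    Tendsto (fun N : ℕ => (∑ i ∈ Finset.range (N + 1), v i) / ((N : ℝ) + 1)) atTop (𝓝 l) := by
  refine (h.cesaro.comp (tendsto_add_atTop_nat 1)).congr fun N => ?_
  simp [div_eq_inv_mul]

lemma IsGauge.modular_cesaro_eventually_le (hG : IsGauge G) {f : ℕ → Ω → ℝ}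
    (hf : ∀ i, Measurable (f i)) {v : ℕ → ℝ} {l : ℝ} (hv0 : ∀ i, 0 ≤ v i)
    (hvl : Tendsto v atTop (𝓝 l)) (hv : ∀ i, modular P G (f i) ≤ ENNReal.ofReal (v i))
    {ε : ℝ} (hε : 0 < ε) :
    ∀ᶠ N in atTop, modular P G (cesaro f N) ≤ ENNReal.ofReal (l + ε) := by
  filter_upwards [(tendsto_average hvl).eventually_le_const (lt_add_of_pos_right l hε)] with N hN
  refine le_trans ?_ (ENNReal.ofReal_le_ofReal hN)
  refine le_trans (lintegral_mono fun ω => ENNReal.ofReal_le_ofReal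
    (hG.average_le (fun i => f i ω) N)) ?_
  exact lintegral_average_le (fun i => hG.measurable.comp (hf i)) (fun i ω => hG.nonneg _) hv0 hv N

lemma IsGauge.sum_disjoint_le (hG : IsGauge G) {x : ℕ → ℝ}
    (hx : ∀ i j, i < j → x i = 0 ∨ x j = 0) (s : Finset ℕ) (t : ℝ) :
    G ((∑ i ∈ s, x i) / t) ≤ ∑ i ∈ s, G (x i / t) := by
  by_cases h : ∃ i ∈ s, x i ≠ 0
  · obtain ⟨i, hi, hxi⟩ := h
    rw [Finset.sum_eq_single_of_mem i hi fun j _ hj => ?_]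
    · exact Finset.single_le_sum (f := fun i => G (x i / t)) (fun j _ => hG.nonneg _) hi
    · rcases lt_or_gt_of_ne hj with hj | hj
      · exact (hx j i hj).resolve_right hxi
      · exact (hx i j hj).resolve_left hxi
  · push Not at h
    rw [Finset.sum_eq_zero h, zero_div, hG.map_zero]
    exact Finset.sum_nonneg fun i _ => hG.nonneg _

/-- The modulars of the Cesàro means of disjoint functions with growing nonzero values vanish. -/
lemma IsGauge.modular_cesaro_disjoint (hG : IsGauge G) {f : ℕ → Ω → ℝ}
    (hf : ∀ i, Measurable (f i)) (hdisj : ∀ ω i j, i < j → f i ω = 0 ∨ f j ω = 0)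
    (hlarge : ∀ i ω, f i ω = 0 ∨ (i : ℝ) ≤ |f i ω|) {C : ℝ} (hC : 0 ≤ C)
    (hfC : ∀ i, modular P G (f i) ≤ ENNReal.ofReal C) {ε : ℝ} (hε : 0 < ε) :
    ∀ᶠ N in atTop, modular P G (cesaro f N) ≤ ENNReal.ofReal ε := by
  set ε' := ε / (2 * (C + 1)) with hε'
  have hε'pos : 0 < ε' := by positivity
  have hε'C : ε' * C < ε := by
    rw [hε', div_mul_eq_mul_div, div_lt_iff₀ (by positivity)]
    nlinarith
  obtain ⟨K, y₀, hK1, hK⟩ := hG.nabla ε' hε'pos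
  set v : ℕ → ℝ := fun i => if y₀ ≤ i then ε' * C else C
  have hv0 : ∀ i, 0 ≤ v i := fun i => by
    simp only [v]; split_ifs <;> positivity
  have hvl : Tendsto v atTop (𝓝 (ε' * C)) := by
    refine tendsto_const_nhds.congr' ?_
    filter_upwards [tendsto_natCast_atTop_atTop.eventually_ge_atTop y₀] with i hi
    simp [v, hi]
  filter_upwards [(tendsto_average hvl).eventually_le_const hε'C,
    tendsto_natCast_atTop_atTop.eventually_ge_atTop K] with N hN hKN
  have hN0 : (0 : ℝ) < N + 1 := by positivity
  refine le_trans ?_ (ENNReal.ofReal_le_ofReal hN)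
  set u : ℕ → Ω → ℝ := fun i ω => (N + 1) * G (f i ω / (N + 1))
  have hu0 : ∀ i ω, 0 ≤ u i ω := fun i ω => mul_nonneg hN0.le (hG.nonneg _)
  have hu : ∀ i, Measurable (u i) := fun i =>
    (hG.measurable.comp ((hf i).div_const _)).const_mul _
  refine le_trans (lintegral_mono fun ω => ENNReal.ofReal_le_ofReal ?_)
    (lintegral_average_le hu hu0 hv0 (fun i => ?_) N)
  · rw [← Finset.mul_sum, mul_div_cancel_left₀ _ hN0.ne']
    exact hG.sum_disjoint_le (fun i j hij => hdisj ω i j hij) _ _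
  · by_cases hi : y₀ ≤ i
    · have : ∀ ω, u i ω ≤ ε' * G (f i ω) := by
        intro ω
        rcases hlarge i ω with h0 | h1
        · simp [u, h0, hG.map_zero]
        · exact hG.nabla_of_le hK1 (by linarith) (hK _ (hi.trans h1))
      calc ∫⁻ ω, ENNReal.ofReal (u i ω) ∂P
          ≤ ∫⁻ ω, ENNReal.ofReal ε' * ENNReal.ofReal (G (f i ω)) ∂P :=
            lintegral_mono fun ω => by
              rw [← ENNReal.ofReal_mul hε'pos.le]
              exact ENNReal.ofReal_le_ofReal (this ω)
        _ = ENNReal.ofReal ε' * modular P G (f i) :=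
            lintegral_const_mul _ (hG.measurable.comp (hf i)).ennreal_ofReal
        _ ≤ ENNReal.ofReal ε' * ENNReal.ofReal C := by gcongr; exact hfC i
        _ = ENNReal.ofReal (v i) := by simp [v, hi, ENNReal.ofReal_mul hε'pos.le]
    · refine le_trans (lintegral_mono fun ω => ENNReal.ofReal_le_ofReal ?_)
        ((hfC i).trans (by simp [v, hi]))
      have := hG.smul_le (t := ((N : ℝ) + 1)⁻¹) (by positivity)
        (inv_le_one_of_one_le₀ (by linarith [(Nat.cast_nonneg N : (0 : ℝ) ≤ N)])) (f i ω)
      simp only [u]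
      rw [div_eq_inv_mul]
      calc _ ≤ ((N : ℝ) + 1) * (((N : ℝ) + 1)⁻¹ * G (f i ω)) :=
            mul_le_mul_of_nonneg_left this hN0.le
        _ = _ := by field_simp

lemma integrable_of_abs_le [IsFiniteMeasure P] {x : Ω → ℝ} (hx : Measurable x) {b : ℝ}
    (hb : ∀ ω, |x ω| ≤ b) : Integrable x P :=
  Integrable.of_bound hx.aestronglyMeasurable b (Eventually.of_forall hb)

lemma integrable_mul_of_abs_le [IsFiniteMeasure P] {x y : Ω → ℝ} (hx : Measurable x)
    (hy : Measurable y) {b b' : ℝ} (hb : ∀ ω, |x ω| ≤ b) (hb' : ∀ ω, |y ω| ≤ b') :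
    Integrable (fun ω => x ω * y ω) P :=
  integrable_of_abs_le (hx.mul hy) fun ω => by
    rw [abs_mul]
    exact mul_le_mul (hb ω) (hb' ω) (abs_nonneg _) ((abs_nonneg _).trans (hb ω))

/-- Variance bound for partial sums of almost orthogonal bounded functions. -/
lemma integral_sq_sum_le [IsProbabilityMeasure P] {x : ℕ → Ω → ℝ} (hx : ∀ i, Measurable (x i))
    {b K : ℝ} (hb : ∀ i ω, |x i ω| ≤ b)
    (hK : ∀ i j, i < j → |∫ ω, x i ω * x j ω ∂P| ≤ K * (1 / 2) ^ j) (N : ℕ) :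
    ∫ ω, (∑ i ∈ Finset.range N, x i ω) ^ 2 ∂P ≤ N * (b ^ 2 + 2 * |K|) := by
  induction N with
  | zero => simp
  | succ N ih =>
    have hsM : Measurable fun ω => ∑ i ∈ Finset.range N, x i ω :=
      Finset.measurable_sum _ fun i _ => hx i
    have hsb : ∀ ω, |∑ i ∈ Finset.range N, x i ω| ≤ N * b := fun ω =>
      (Finset.abs_sum_le_sum_abs _ _).trans
        ((Finset.sum_le_sum fun i _ => hb i ω).trans (by simp))
    have hss := integrable_mul_of_abs_le (P := P) hsM hsM hsb hsb
    have hxx := integrable_mul_of_abs_le (P := P) (hx N) (hx N) (hb N) (hb N)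
    have hprod : ∀ i, Integrable (fun ω => x i ω * x N ω) P := fun i =>
      integrable_mul_of_abs_le (hx i) (hx N) (hb i) (hb N)
    have hsx : Integrable (fun ω => ∑ i ∈ Finset.range N, x i ω * x N ω) P :=
      integrable_finsetSum _ fun i _ => hprod i
    have hexp : ∀ ω, (∑ i ∈ Finset.range (N + 1), x i ω) ^ 2 =
        (∑ i ∈ Finset.range N, x i ω) * (∑ i ∈ Finset.range N, x i ω) +
        2 * (∑ i ∈ Finset.range N, x i ω * x N ω) + x N ω * x N ω := fun ω => by
      rw [Finset.sum_range_succ, ← Finset.sum_mul]; ring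
    simp_rw [hexp]
    have hsum : Integrable (fun ω => (∑ i ∈ Finset.range N, x i ω) *
        (∑ i ∈ Finset.range N, x i ω) + 2 * (∑ i ∈ Finset.range N, x i ω * x N ω)) P :=
      hss.add (hsx.const_mul 2)
    rw [integral_add hsum hxx, integral_add hss (hsx.const_mul 2),
      integral_const_mul, integral_finsetSum _ fun i _ => hprod i]
    have h1 : ∑ i ∈ Finset.range N, ∫ ω, x i ω * x N ω ∂P ≤ |K| := by
      calc ∑ i ∈ Finset.range N, ∫ ω, x i ω * x N ω ∂P
          ≤ ∑ i ∈ Finset.range N, |K| * (1 / 2) ^ N := Finset.sum_le_sum fun i hi =>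
            (le_abs_self _).trans ((hK i N (Finset.mem_range.1 hi)).trans
              (mul_le_mul_of_nonneg_right (le_abs_self K) (by positivity)))
        _ = |K| * (N * (1 / 2) ^ N) := by simp; ring
        _ ≤ |K| * 1 := by
            refine mul_le_mul_of_nonneg_left ?_ (abs_nonneg K)
            have : (N : ℝ) ≤ 2 ^ N := by exact_mod_cast Nat.lt_two_pow_self.le
            rw [one_div, inv_pow, ← div_eq_mul_inv]
            exact div_le_one_of_le₀ this (by positivity)
        _ = |K| := mul_one _
    have h2 : ∫ ω, x N ω * x N ω ∂P ≤ b ^ 2 := by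
      calc ∫ ω, x N ω * x N ω ∂P ≤ ∫ _, b ^ 2 ∂P := integral_mono hxx (integrable_const _)
            fun ω => by
              simp only
              rw [← pow_two]
              exact sq_le_sq' (by linarith [neg_abs_le (x N ω), hb N ω])
                ((le_abs_self _).trans (hb N ω))
        _ = b ^ 2 := by simp
    simp_rw [pow_two (∑ i ∈ Finset.range N, x i _)] at ih
    push_cast
    linarith

/-- The modulars of the Cesàro means of bounded almost orthogonal functions vanish. -/
lemma IsGauge.modular_cesaro_orthogonal [IsProbabilityMeasure P] (hG : IsGauge G)
    {x : ℕ → Ω → ℝ} (hx : ∀ i, Measurable (x i)) {b K : ℝ} (hb : ∀ i ω, |x i ω| ≤ b)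
    (hK : ∀ i j, i < j → |∫ ω, x i ω * x j ω ∂P| ≤ K * (1 / 2) ^ j) {ε : ℝ} (hε : 0 < ε) :
    ∀ᶠ N in atTop, modular P G (cesaro x N) ≤ ENNReal.ofReal ε := by
  set L := G (b + 1)
  have hL : 0 ≤ L := hG.nonneg _
  have hne : Nonempty Ω := nonempty_of_isProbabilityMeasure P
  have hb0 : 0 ≤ b := (abs_nonneg _).trans (hb 0 hne.some)
  set t := ε / (2 * (L + 1)) with ht
  have htpos : 0 < t := by positivity
  set V := b ^ 2 + 2 * |K|
  have hlim : Tendsto (fun N : ℕ => L * (t + 1 / t * (V / ((N : ℝ) + 1)))) atTop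
      (𝓝 (L * (t + 1 / t * 0))) :=
    ((((tendsto_const_nhds.div_atTop (tendsto_atTop_add_const_right _ _
      tendsto_natCast_atTop_atTop)).const_mul _).const_add _).const_mul _)
  have hlt : L * (t + 1 / t * 0) < ε := by
    rw [mul_zero, add_zero, ht, mul_div_assoc', div_lt_iff₀ (by positivity)]
    nlinarith
  filter_upwards [hlim.eventually_le_const hlt] with N hN
  have hN0 : (0 : ℝ) < N + 1 := by positivity
  have hsq : ∀ ω, (cesaro x N ω) ^ 2 =
      (1 / ((N : ℝ) + 1) ^ 2) * (∑ i ∈ Finset.range (N + 1), x i ω) ^ 2 := fun ω => by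
    simp only [cesaro]; rw [div_pow]; ring
  have hcb : ∀ ω, |cesaro x N ω| ≤ b := fun ω => by
    simp only [cesaro]
    rw [abs_div, abs_of_pos hN0, div_le_iff₀ hN0]
    exact (Finset.abs_sum_le_sum_abs _ _).trans
        ((Finset.sum_le_sum fun i _ => hb i ω).trans (by simp [mul_comm]))
  have hcm : Measurable (cesaro x N) := measurable_cesaro hx N
  have hint : Integrable (fun ω => (cesaro x N ω) ^ 2) P := by
    simpa only [pow_two] using integrable_mul_of_abs_le (P := P) hcm hcm hcb hcb
  have hvar : ∫ ω, (cesaro x N ω) ^ 2 ∂P ≤ V / (N + 1) := by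
    simp_rw [hsq]
    rw [integral_const_mul]
    have := integral_sq_sum_le (P := P) hx hb hK (N + 1)
    calc _ ≤ 1 / ((N : ℝ) + 1) ^ 2 * (((N + 1 : ℕ) : ℝ) * V) :=
          mul_le_mul_of_nonneg_left this (by positivity)
      _ = _ := by push_cast; field_simp
  have hpt : ∀ ω, G (cesaro x N ω) ≤ L * (t + 1 / t * (cesaro x N ω) ^ 2) := by
    intro ω
    set y := cesaro x N ω
    have h1 := hG.smul_le (t := |y| / (b + 1)) (by positivity)
      ((div_le_one (by positivity)).2 (by linarith [hcb ω])) (b + 1)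
    rw [div_mul_cancel₀ _ (by positivity), even_convex_abs hG.even] at h1
    have h2 : |y| / (b + 1) ≤ |y| := div_le_self (abs_nonneg _) (by linarith)
    have h3 : |y| ≤ t + 1 / t * y ^ 2 := by
      rw [← sq_abs y]
      have : t + 1 / t * |y| ^ 2 - |y| = 1 / t * (t ^ 2 - t * |y| + |y| ^ 2) := by
        field_simp; ring
      have h4 : 0 ≤ 1 / t * (t ^ 2 - t * |y| + |y| ^ 2) := by
        refine mul_nonneg (by positivity) ?_
        nlinarith [sq_nonneg (t - |y|), mul_nonneg htpos.le (abs_nonneg y)]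
      linarith
    calc G y ≤ |y| / (b + 1) * L := h1
      _ ≤ (t + 1 / t * y ^ 2) * L := mul_le_mul_of_nonneg_right (h2.trans h3) hL
      _ = _ := mul_comm _ _
  have hint' : Integrable (fun ω => L * (t + 1 / t * (cesaro x N ω) ^ 2)) P :=
    ((integrable_const t).add (hint.const_mul _)).const_mul _
  calc modular P G (cesaro x N)
      ≤ ∫⁻ ω, ENNReal.ofReal (L * (t + 1 / t * (cesaro x N ω) ^ 2)) ∂P :=
        lintegral_mono fun ω => ENNReal.ofReal_le_ofReal (hpt ω)
    _ = ENNReal.ofReal (∫ ω, L * (t + 1 / t * (cesaro x N ω) ^ 2) ∂P) :=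
        (ofReal_integral_eq_lintegral_ofReal hint' (Eventually.of_forall fun ω => by
          simp only [Pi.zero_apply]; positivity)).symm
    _ ≤ ENNReal.ofReal ε := ENNReal.ofReal_le_ofReal (by
        rw [integral_const_mul, integral_add (integrable_const t) (hint.const_mul _),
          integral_const_mul]
        refine le_trans ?_ hN
        simp only [integral_const, probReal_univ, smul_eq_mul, one_mul]
        gcongr)

end Modular

section WeakLimit

/-- Bounded sequences of a Hilbert space have weak limits along ultrafilters. -/
lemma exists_weak_limit {E : Type*} [NormedAddCommGroup E] [InnerProductSpace ℝ E]
    [CompleteSpace E] (U : Ultrafilter ℕ) (x : ℕ → E) {b : ℝ} (hb : ∀ n, ‖x n‖ ≤ b) :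
    ∃ z : E, ∀ y : E, Tendsto (fun n => inner ℝ (x n) y) U (𝓝 (inner ℝ z y)) := by
  set φ : ℕ → WeakDual ℝ E := fun n =>
    StrongDual.toWeakDual (InnerProductSpace.toDual ℝ E (x n)) with hφ
  have hcomp := WeakDual.isCompact_closedBall (𝕜 := ℝ) (E := E) 0 b
  obtain ⟨ψ, -, hψ⟩ := hcomp.ultrafilter_le_nhds (U.map φ) (by
    rw [le_principal_iff, Ultrafilter.coe_map, mem_map]
    refine Eventually.of_forall fun n => ?_
    simpa [hφ] using hb n)
  refine ⟨(InnerProductSpace.toDual ℝ E).symm (WeakDual.toStrongDual ψ), fun y => ?_⟩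
  have h1 : Tendsto (fun n => φ n y) U (𝓝 (ψ y)) :=
    ((WeakDual.eval_continuous y).tendsto ψ).comp hψ
  have h2 : inner ℝ ((InnerProductSpace.toDual ℝ E).symm (WeakDual.toStrongDual ψ)) y = ψ y :=
    InnerProductSpace.toDual_symm_apply
  rw [h2]
  exact h1

variable {Ω : Type*} [MeasurableSpace Ω] {P : Measure Ω} [IsProbabilityMeasure P]

/-- A uniformly bounded sequence of functions has an equally bounded weak `L²`-limit along any
ultrafilter. -/
lemma exists_bounded_weak_limit (U : Ultrafilter ℕ) {x : ℕ → Ω → ℝ}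
    (hx : ∀ n, Measurable (x n)) {b : ℝ} (hb : ∀ n ω, |x n ω| ≤ b) :
    ∃ z : Ω → ℝ, Measurable z ∧ (∀ ω, |z ω| ≤ b) ∧
      ∀ i, Tendsto (fun n => ∫ ω, (x i ω - z ω) * (x n ω - z ω) ∂P) U (𝓝 0) := by
  have hne : Nonempty Ω := nonempty_of_isProbabilityMeasure P
  have hb0 : 0 ≤ b := (abs_nonneg _).trans (hb 0 hne.some)
  have hmem : ∀ y : Ω → ℝ, Measurable y → (∃ b', ∀ ω, |y ω| ≤ b') → MemLp y 2 P := by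
    rintro y hy ⟨b', hb'⟩
    exact MemLp.of_bound hy.aestronglyMeasurable b' (Eventually.of_forall hb')
  have hxm : ∀ n, MemLp (x n) 2 P := fun n => hmem _ (hx n) ⟨b, hb n⟩
  obtain ⟨Z, hZ⟩ := exists_weak_limit U (fun n => (hxm n).toLp (x n)) (b := b) (fun n => by
    refine (Lp.norm_le_of_ae_bound hb0 ?_).trans (by simp [measureUnivNNReal])
    filter_upwards [(hxm n).coeFn_toLp] with ω hω
    rw [hω]
    exact hb n ω)
  have hZI : Integrable Z P := (Lp.memLp Z).integrable (by norm_num)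
  have hset : ∀ s, MeasurableSet s →
      Tendsto (fun n => ∫ ω in s, x n ω ∂P) U (𝓝 (∫ ω in s, Z ω ∂P)) := by
    intro s hs
    have h1 := hZ (indicatorConstLp 2 hs (measure_ne_top P s) (1 : ℝ))
    simp_rw [real_inner_comm (indicatorConstLp 2 hs (measure_ne_top P s) (1 : ℝ))] at h1
    simp_rw [L2.inner_indicatorConstLp_one hs (measure_ne_top P s)] at h1
    refine h1.congr fun n => setIntegral_congr_ae hs ?_
    filter_upwards [(hxm n).coeFn_toLp] with ω hω _
    exact hω
  have hxI : ∀ n, Integrable (x n) P := fun n => integrable_of_abs_le (hx n) (hb n)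
  have hle : Z ≤ᵐ[P] fun _ => b :=
    ae_le_of_forall_setIntegral_le hZI (integrable_const b) fun s hs _ =>
      le_of_tendsto (hset s hs) (Eventually.of_forall fun n =>
        integral_mono (hxI n).integrableOn (integrable_const b) fun ω =>
          (le_abs_self _).trans (hb n ω))
  have hge : (fun _ => -b) ≤ᵐ[P] Z :=
    ae_le_of_forall_setIntegral_le (integrable_const (-b)) hZI fun s hs _ =>
      ge_of_tendsto (hset s hs) (Eventually.of_forall fun n =>
        integral_mono (integrable_const (-b)) (hxI n).integrableOn fun ω =>
          (abs_le.1 (hb n ω)).1)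
  set Z' := (Lp.aestronglyMeasurable Z).mk Z
  have hZ' : Measurable Z' := (Lp.aestronglyMeasurable Z).stronglyMeasurable_mk.measurable
  set z : Ω → ℝ := fun ω => max (-b) (min b (Z' ω)) with hz
  have hzm : Measurable z := measurable_const.max (measurable_const.min hZ')
  have hzb : ∀ ω, |z ω| ≤ b := fun ω =>
    abs_le.2 ⟨le_max_left _ _, max_le (by linarith) (min_le_left _ _)⟩
  have hzZ : z =ᵐ[P] Z := by
    filter_upwards [hle, hge, (Lp.aestronglyMeasurable Z).ae_eq_mk] with ω h1 h2 h3
    simp only [hz]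
    rw [show Z' ω = Z ω from h3.symm, min_eq_right h1, max_eq_right h2]
  refine ⟨z, hzm, hzb, fun i => ?_⟩
  have hym : MemLp (fun ω => x i ω - z ω) 2 P := hmem _ ((hx i).sub hzm) ⟨b + b, fun ω =>
    (abs_sub _ _).trans (add_le_add (hb i ω) (hzb ω))⟩
  have hlim := (hZ (hym.toLp _)).sub_const (inner ℝ Z (hym.toLp _))
  rw [sub_self] at hlim
  refine hlim.congr fun n => ?_
  rw [← inner_sub_left, L2.inner_def]
  refine integral_congr_ae ?_
  filter_upwards [hym.coeFn_toLp, Lp.coeFn_sub ((hxm n).toLp (x n)) Z, (hxm n).coeFn_toLp, hzZ]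
    with ω h1 h2 h3 h4
  rw [h1, h2, Pi.sub_apply, h3, ← h4]
  rfl

end WeakLimit

section Splitting

variable {Ω : Type*} [MeasurableSpace Ω] {P : Measure Ω} {G : ℝ → ℝ}

/-- The truncation `f 1_{|f| ≤ c}`. -/
def trunc {Ω : Type*} (c : ℝ) (f : Ω → ℝ) : Ω → ℝ := {ω | |f ω| ≤ c}.indicator f

lemma measurable_trunc (c : ℝ) {f : Ω → ℝ} (hf : Measurable f) : Measurable (trunc c f) :=
  hf.indicator (measurableSet_le hf.abs measurable_const)

lemma abs_trunc_le {Ω : Type*} {c : ℝ} (hc : 0 ≤ c) (f : Ω → ℝ) (ω : Ω) : |trunc c f ω| ≤ c := by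
  by_cases h : |f ω| ≤ c
  · rwa [trunc, indicator_of_mem (by exact h)]
  · rwa [trunc, indicator_of_notMem (by exact h), abs_zero]

/-- A bounded sequence that splits at each level `c` into an almost orthogonal bounded part, a
middle part of small modular, and an almost disjoint part living above the levels `a i`. -/
structure IsSplit (P : Measure Ω) (G : ℝ → ℝ) (C : ℝ) (δ K : ℕ → ℝ) (ζ : ℕ → Ω → ℝ)
    (a : ℕ → ℝ) (f : ℕ → Ω → ℝ) : Prop where
  meas : ∀ i, Measurable (f i)
  bound : ∀ i, modular P G (f i) ≤ ENNReal.ofReal C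
  level : ∀ i : ℕ, (i : ℝ) ≤ a i
  tail : ∀ i j, i < j →
    ∫⁻ ω in {ω | a j < |f j ω|}, ENNReal.ofReal (G (f i ω)) ∂P ≤ ENNReal.ofReal ((1 / 2) ^ j)
  middle : ∀ c i : ℕ, modular P G ({ω | c < |f i ω| ∧ |f i ω| ≤ a i}.indicator (f i)) ≤
    ENNReal.ofReal (δ c + K c * (1 / 2) ^ i)
  orth : ∀ c i j : ℕ, i < j →
    |∫ ω, (trunc c (f i) ω - ζ c ω) * (trunc c (f j) ω - ζ c ω) ∂P| ≤ K c * (1 / 2) ^ j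

lemma IsSplit.comp {C : ℝ} {δ K : ℕ → ℝ} {ζ : ℕ → Ω → ℝ} {a : ℕ → ℝ} {f : ℕ → Ω → ℝ}
    (hK : ∀ c, 0 ≤ K c) (h : IsSplit P G C δ K ζ a f) {k : ℕ → ℕ} (hk : StrictMono k) :
    IsSplit P G C δ K ζ (a ∘ k) (f ∘ k) := by
  have hpow : ∀ i, (1 / 2 : ℝ) ^ k i ≤ (1 / 2) ^ i := fun i =>
    pow_le_pow_of_le_one (by norm_num) (by norm_num) (hk.le_apply)
  refine ⟨fun i => h.meas _, fun i => h.bound _, fun i => ?_, fun i j hij => ?_, fun c i => ?_,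
    fun c i j hij => ?_⟩
  · exact (Nat.cast_le.2 hk.le_apply).trans (h.level (k i))
  · exact (h.tail _ _ (hk hij)).trans (ENNReal.ofReal_le_ofReal (hpow j))
  · refine (h.middle c (k i)).trans (ENNReal.ofReal_le_ofReal ?_)
    have := mul_le_mul_of_nonneg_left (hpow i) (hK c)
    linarith
  · exact (h.orth c _ _ (hk hij)).trans (mul_le_mul_of_nonneg_left (hpow j) (hK c))

/-- The Cesàro means of a split sequence are eventually `δ c`-close to the weak limit `ζ c` of
the truncations at level `c`. -/
lemma IsSplit.modular_cesaro_sub_le [IsProbabilityMeasure P] (hG : IsGauge G) {C : ℝ}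
    {δ K : ℕ → ℝ} {ζ : ℕ → Ω → ℝ} {a : ℕ → ℝ} {f : ℕ → Ω → ℝ} (hC : 0 ≤ C)
    (hδ : ∀ c, 0 ≤ δ c) (hK : ∀ c, 0 ≤ K c) (hζ : ∀ c, Measurable (ζ c))
    (hζb : ∀ c ω, |ζ c ω| ≤ c) (h : IsSplit P G C δ K ζ a f) (c : ℕ) {ε : ℝ} (hε : 0 < ε) :
    ∀ᶠ N in atTop,
      modular P G (fun ω => (cesaro f N ω - ζ c ω) / 4) ≤ ENNReal.ofReal (δ c + ε) := by
  have hf := h.meas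
  have hfabs : ∀ i, Measurable fun ω => |f i ω| := fun i => (hf i).abs
  have hBm : ∀ j, MeasurableSet {ω | a j < |f j ω|} := fun j =>
    measurableSet_lt measurable_const (hfabs j)
  set T : ℕ → Set Ω := fun i => ⋃ j, {ω | a (i + 1 + j) < |f (i + 1 + j) ω|}
  have hTm : ∀ i, MeasurableSet (T i) := fun i => MeasurableSet.iUnion fun j => hBm _
  set D : ℕ → Set Ω := fun i => {ω | max (a i) c < |f i ω|} \ T i
  have hDm : ∀ i, MeasurableSet (D i) := fun i =>
    (measurableSet_lt measurable_const (hfabs i)).diff (hTm i)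
  set β : ℕ → Ω → ℝ := fun i => (D i).indicator (f i)
  set r : ℕ → Ω → ℝ := fun i => ({ω | (c : ℝ) < |f i ω|} \ D i).indicator (f i)
  set x : ℕ → Ω → ℝ := fun i ω => trunc c (f i) ω - ζ c ω
  have hβm : ∀ i, Measurable (β i) := fun i => (hf i).indicator (hDm i)
  have hrm : ∀ i, Measurable (r i) := fun i =>
    (hf i).indicator ((measurableSet_lt measurable_const (hfabs i)).diff (hDm i))
  have hxm : ∀ i, Measurable (x i) := fun i => (measurable_trunc c (hf i)).sub (hζ c)
  have hdecomp : ∀ i ω, f i ω = trunc c (f i) ω + r i ω + β i ω := by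
    intro i ω
    by_cases h1 : |f i ω| ≤ c
    · have h2 : ω ∉ D i := fun hD => absurd (lt_of_le_of_lt (le_max_right (a i) (c : ℝ)) hD.1)
        (not_lt.2 h1)
      simp [trunc, r, β, h1, h2, not_lt.2 h1]
    · by_cases h2 : ω ∈ D i
      · simp [trunc, r, β, h1, h2]
      · simp [trunc, r, β, h1, h2, not_le.1 h1]
  have hcesaro : ∀ N ω, (cesaro f N ω - ζ c ω) / 4 =
      (cesaro x N ω + cesaro r N ω + cesaro β N ω) / 4 := by
    intro N ω
    have hN : (N : ℝ) + 1 ≠ 0 := by positivity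
    simp only [cesaro]
    rw [Finset.sum_congr rfl fun i _ => hdecomp i ω]
    simp only [Finset.sum_add_distrib, x, Finset.sum_sub_distrib, Finset.sum_const,
      Finset.card_range, nsmul_eq_mul]
    push_cast
    field_simp
    ring
  have hTint : ∀ i, ∫⁻ ω in T i, ENNReal.ofReal (G (f i ω)) ∂P ≤
      ENNReal.ofReal ((1 / 2) ^ i) := by
    intro i
    have hsum : HasSum (fun j : ℕ => (1 / 2 : ℝ) ^ (i + 1 + j)) ((1 / 2) ^ i) := by
      convert hasSum_geometric_two' ((1 / 2 : ℝ) ^ i) using 2 with j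
      rw [pow_add, pow_succ, one_div, inv_pow 2 j]
      ring
    calc ∫⁻ ω in T i, ENNReal.ofReal (G (f i ω)) ∂P
        ≤ ∑' j, ∫⁻ ω in {ω | a (i + 1 + j) < |f (i + 1 + j) ω|},
            ENNReal.ofReal (G (f i ω)) ∂P := lintegral_iUnion_le _ _
      _ ≤ ∑' j, ENNReal.ofReal ((1 / 2) ^ (i + 1 + j)) :=
          ENNReal.tsum_le_tsum fun j => h.tail i _ (by omega)
      _ = ENNReal.ofReal ((1 / 2) ^ i) := by
          rw [← ENNReal.ofReal_tsum_of_nonneg (fun j => by positivity) hsum.summable,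
            hsum.tsum_eq]
  have hrle : ∀ i, modular P G (r i) ≤ ENNReal.ofReal (δ c + (K c + 1) * (1 / 2) ^ i) := by
    intro i
    have hpt : ∀ ω, ENNReal.ofReal (G (r i ω)) ≤
        ENNReal.ofReal (G ({ω | c < |f i ω| ∧ |f i ω| ≤ a i}.indicator (f i) ω)) +
        (T i).indicator (fun ω => ENNReal.ofReal (G (f i ω))) ω := by
      intro ω
      by_cases hω : ω ∈ {ω | (c : ℝ) < |f i ω|} \ D i
      · have hrω : r i ω = f i ω := indicator_of_mem hω _
        rw [hrω]
        by_cases hT : ω ∈ T i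
        · rw [indicator_of_mem hT]
          exact le_add_self
        · have hmax : ¬ max (a i) c < |f i ω| := fun hm => hω.2 ⟨hm, hT⟩
          have hle : |f i ω| ≤ a i := (le_max_iff.1 (not_lt.1 hmax)).resolve_right
            (not_le.2 hω.1)
          rw [indicator_of_mem (show ω ∈ {ω | c < |f i ω| ∧ |f i ω| ≤ a i} from ⟨hω.1, hle⟩)]
          exact le_self_add
      · have hrω : r i ω = 0 := indicator_of_notMem hω _
        simp [hrω, hG.map_zero]
    calc modular P G (r i)
        ≤ ∫⁻ ω, (ENNReal.ofReal (G ({ω | c < |f i ω| ∧ |f i ω| ≤ a i}.indicator (f i) ω)) +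
          (T i).indicator (fun ω => ENNReal.ofReal (G (f i ω))) ω) ∂P := lintegral_mono hpt
      _ = modular P G ({ω | c < |f i ω| ∧ |f i ω| ≤ a i}.indicator (f i)) +
          ∫⁻ ω in T i, ENNReal.ofReal (G (f i ω)) ∂P := by
          have hm : Measurable fun ω => ENNReal.ofReal (G (f i ω)) :=
            (hG.measurable.comp (hf i)).ennreal_ofReal
          rw [lintegral_add_right _ (hm.indicator (hTm i)), lintegral_indicator (hTm i)]
          rfl
      _ ≤ ENNReal.ofReal (δ c + K c * (1 / 2) ^ i) + ENNReal.ofReal ((1 / 2) ^ i) :=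
          add_le_add (h.middle c i) (hTint i)
      _ = ENNReal.ofReal (δ c + (K c + 1) * (1 / 2) ^ i) := by
          rw [← ENNReal.ofReal_add (add_nonneg (hδ c) (mul_nonneg (hK c) (by positivity)))
            (by positivity)]
          congr 1
          ring
  have hv0 : ∀ i : ℕ, 0 ≤ δ c + (K c + 1) * (1 / 2) ^ i := fun i =>
    add_nonneg (hδ c) (mul_nonneg (by linarith [hK c]) (by positivity))
  have hvl : Tendsto (fun i : ℕ => δ c + (K c + 1) * (1 / 2 : ℝ) ^ i) atTop (𝓝 (δ c)) := by
    simpa using ((tendsto_pow_atTop_nhds_zero_of_lt_one (by norm_num : (0 : ℝ) ≤ 1 / 2)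
      (by norm_num)).const_mul (K c + 1)).const_add (δ c)
  have hε3 : 0 < ε / 3 := by positivity
  have hβdisj : ∀ ω i j, i < j → β i ω = 0 ∨ β j ω = 0 := by
    intro ω i j hij
    by_cases hi : ω ∈ D i
    · right
      refine indicator_of_notMem (fun hj => hi.2 ?_) _
      refine mem_iUnion.2 ⟨j - (i + 1), ?_⟩
      rw [show i + 1 + (j - (i + 1)) = j by omega]
      have hj1 : max (a j) c < |f j ω| := hj.1
      exact (le_max_left _ _).trans_lt hj1
    · exact Or.inl (indicator_of_notMem hi _)
  have hβlarge : ∀ (i : ℕ) ω, β i ω = 0 ∨ (i : ℝ) ≤ |β i ω| := by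
    intro i ω
    by_cases hi : ω ∈ D i
    · right
      rw [show β i ω = f i ω from indicator_of_mem hi _]
      exact (h.level i).trans ((le_max_left _ _).trans hi.1.le)
    · exact Or.inl (indicator_of_notMem hi _)
  have hβC : ∀ i, modular P G (β i) ≤ ENNReal.ofReal C := fun i =>
    (lintegral_mono fun ω => ENNReal.ofReal_le_ofReal (hG.mono
      (norm_indicator_le_norm_self (f i) ω))).trans (h.bound i)
  filter_upwards [hG.modular_cesaro_orthogonal (P := P) hxm (b := c + c) (fun i ω =>
      (abs_sub _ _).trans (add_le_add (abs_trunc_le c.cast_nonneg _ ω) (hζb c ω)))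
      (fun i j hij => h.orth c i j hij) hε3,
    hG.modular_cesaro_eventually_le hrm hv0 hvl hrle hε3,
    hG.modular_cesaro_disjoint hβm hβdisj hβlarge hC hβC hε3] with N h1 h2 h3
  have hm : ∀ {g : ℕ → Ω → ℝ}, (∀ i, Measurable (g i)) →
      Measurable fun ω => ENNReal.ofReal (G (cesaro g N ω)) := fun hg =>
    (hG.measurable.comp (measurable_cesaro hg N)).ennreal_ofReal
  calc modular P G (fun ω => (cesaro f N ω - ζ c ω) / 4)
      ≤ ∫⁻ ω, (ENNReal.ofReal (G (cesaro x N ω)) + ENNReal.ofReal (G (cesaro r N ω)) +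
          ENNReal.ofReal (G (cesaro β N ω))) ∂P := lintegral_mono fun ω => by
        rw [← ENNReal.ofReal_add (hG.nonneg _) (hG.nonneg _),
          ← ENNReal.ofReal_add (add_nonneg (hG.nonneg _) (hG.nonneg _)) (hG.nonneg _),
          show (fun ω => (cesaro f N ω - ζ c ω) / 4) ω = _ from hcesaro N ω]
        exact ENNReal.ofReal_le_ofReal (hG.quarter_add_le _ _ _)
    _ = modular P G (cesaro x N) + modular P G (cesaro r N) + modular P G (cesaro β N) := by
        rw [lintegral_add_right _ (hm hβm), lintegral_add_right _ (hm hrm)]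
        rfl
    _ ≤ ENNReal.ofReal (ε / 3) + ENNReal.ofReal (δ c + ε / 3) + ENNReal.ofReal (ε / 3) :=
        add_le_add (add_le_add h1 h2) h3
    _ = ENNReal.ofReal (δ c + ε) := by
        rw [← ENNReal.ofReal_add hε3.le (add_nonneg (hδ c) hε3.le),
          ← ENNReal.ofReal_add (add_nonneg hε3.le (add_nonneg (hδ c) hε3.le)) hε3.le]
        congr 1
        ring

end Splitting

section Extraction

variable {Ω : Type*} [MeasurableSpace Ω] {P : Measure Ω} {G : ℝ → ℝ}

lemma IsGauge.modular_indicator_le (hG : IsGauge G) (s : Set Ω) (f : Ω → ℝ) :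
    modular P G (s.indicator f) ≤ modular P G f :=
  lintegral_mono fun ω => ENNReal.ofReal_le_ofReal (hG.mono (norm_indicator_le_norm_self f ω))

lemma IsGauge.modular_trunc_mono (hG : IsGauge G) {c d : ℝ} (hcd : c ≤ d) (f : Ω → ℝ) :
    modular P G (trunc c f) ≤ modular P G (trunc d f) :=
  lintegral_mono fun ω => ENNReal.ofReal_le_ofReal <| hG.mono <|
    norm_indicator_le_of_subset (fun _ h => le_trans h hcd) f ω

lemma IsGauge.modular_middle_add (hG : IsGauge G) {c d : ℝ} (hcd : c ≤ d) {f : Ω → ℝ}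
    (hf : Measurable f) :
    modular P G ({ω | c < |f ω| ∧ |f ω| ≤ d}.indicator f) + modular P G (trunc c f) =
      modular P G (trunc d f) := by
  have hm : Measurable fun ω => ENNReal.ofReal (G (trunc c f ω)) :=
    (hG.measurable.comp (measurable_trunc c hf)).ennreal_ofReal
  unfold modular
  rw [← lintegral_add_right _ hm]
  refine lintegral_congr fun ω => ?_
  by_cases h1 : |f ω| ≤ c
  · simp [trunc, h1, not_lt.2 h1, h1.trans hcd, hG.map_zero]
  · by_cases h2 : |f ω| ≤ d <;> simp [trunc, h1, h2, not_le.1 h1, hG.map_zero]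

/-- A modular-bounded sequence is uniformly tight, so that a fixed function of finite modular has
small modular on high level sets of the sequence. -/
lemma IsGauge.eventually_setLIntegral_le (hG : IsGauge G) {C : ℝ} {ξ : ℕ → Ω → ℝ}
    (hξ : ∀ n, Measurable (ξ n)) (hb : ∀ n, modular P G (ξ n) ≤ ENNReal.ofReal C)
    (i : ℕ) {ε : ℝ≥0∞} (hε : ε ≠ 0) :
    ∀ᶠ a : ℕ in atTop, ∀ n,
      ∫⁻ ω in {ω | (a : ℝ) < |ξ n ω|}, ENNReal.ofReal (G (ξ i ω)) ∂P ≤ ε := by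
  obtain ⟨η, hη, hsmall⟩ := exists_pos_setLIntegral_lt_of_measure_lt
    (lt_of_le_of_lt (hb i) ENNReal.ofReal_lt_top).ne hε
  have hlim : Tendsto (fun a : ℕ => ENNReal.ofReal C / (a : ℝ≥0∞)) atTop (𝓝 0) := by
    simpa using ENNReal.Tendsto.const_div ENNReal.tendsto_nat_nhds_top
      (Or.inr ENNReal.ofReal_ne_top)
  filter_upwards [hlim.eventually_lt_const hη, eventually_gt_atTop 0] with a ha ha0 n
  refine (hsmall _ (lt_of_le_of_lt ?_ ha)).le
  rw [ENNReal.le_div_iff_mul_le (Or.inl (by exact_mod_cast ha0.ne')) (Or.inl (by simp)), mul_comm]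
  have hm : Measurable fun ω => ENNReal.ofReal (G (ξ n ω)) :=
    (hG.measurable.comp (hξ n)).ennreal_ofReal
  refine le_trans ?_ ((mul_meas_ge_le_lintegral (μ := P) hm (a : ℝ≥0∞)).trans (hb n))
  gcongr with ω
  intro hω
  rw [← ENNReal.ofReal_natCast]
  exact ENNReal.ofReal_le_ofReal (hω.le.trans (hG.abs_le _))

/-- Every modular-bounded sequence has a split subsequence. -/
lemma IsGauge.exists_isSplit [IsProbabilityMeasure P] (hG : IsGauge G) {C : ℝ} (hC : 0 ≤ C)
    {ξ : ℕ → Ω → ℝ} (hξ : ∀ n, Measurable (ξ n))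
    (hb : ∀ n, modular P G (ξ n) ≤ ENNReal.ofReal C) :
    ∃ (n : ℕ → ℕ) (δ K : ℕ → ℝ) (ζ : ℕ → Ω → ℝ) (a : ℕ → ℝ), StrictMono n ∧
      (∀ c, 0 ≤ δ c) ∧ Tendsto δ atTop (𝓝 0) ∧ (∀ c, 0 ≤ K c) ∧ (∀ c, Measurable (ζ c)) ∧
      (∀ c ω, |ζ c ω| ≤ c) ∧ IsSplit P G C δ K ζ a (ξ ∘ n) := by
  set U : Ultrafilter ℕ := hyperfilter ℕ
  choose ζ hζm hζb hζlim using fun c : ℕ => exists_bounded_weak_limit (P := P) U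
    (fun n => measurable_trunc c (hξ n)) (fun n ω => abs_trunc_le c.cast_nonneg (ξ n) ω)
  have hfin : ∀ (n : ℕ) (s : Set Ω), modular P G (s.indicator (ξ n)) ≠ ⊤ := fun n s =>
    (lt_of_le_of_lt ((hG.modular_indicator_le s _).trans (hb n)) ENNReal.ofReal_lt_top).ne
  set m : ℕ → ℕ → ℝ := fun n c => (modular P G (trunc c (ξ n))).toReal with hm
  have hmC : ∀ n c, m n c ≤ C := fun n c =>
    ENNReal.toReal_le_of_le_ofReal hC ((hG.modular_indicator_le _ _).trans (hb n))
  have hmono : ∀ n c d, c ≤ d → m n c ≤ m n d := fun n c d hcd =>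
    ENNReal.toReal_mono (hfin n _) (hG.modular_trunc_mono (Nat.cast_le.2 hcd) _)
  have hlimex : ∀ c, ∃ l, Tendsto (fun n => m n c) U (𝓝 l) := fun c => by
    obtain ⟨l, -, hl⟩ := (isCompact_Icc (a := (0 : ℝ)) (b := C)).ultrafilter_le_nhds
      (U.map fun n => m n c) (by
        rw [le_principal_iff, Ultrafilter.coe_map, mem_map]
        exact Eventually.of_forall fun n => ⟨ENNReal.toReal_nonneg, hmC n c⟩)
    exact ⟨l, hl⟩
  choose h hh using hlimex
  have hhmono : Monotone h := fun c d hcd =>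
    le_of_tendsto_of_tendsto' (hh c) (hh d) fun n => hmono n c d hcd
  have hhbdd : BddAbove (range h) :=
    ⟨C, by rintro _ ⟨c, rfl⟩; exact le_of_tendsto' (hh c) fun n => hmC n c⟩
  have hhlim := tendsto_atTop_ciSup hhmono hhbdd
  have hα : ∀ k : ℕ, ∃ α : ℕ, k ≤ α ∧ ∀ i ≤ k, ∀ n,
      ∫⁻ ω in {ω | (α : ℝ) < |ξ n ω|}, ENNReal.ofReal (G (ξ i ω)) ∂P ≤
        ENNReal.ofReal ((1 / 2) ^ k) := fun k => by
    have hall := (Set.finite_Iic k).eventually_all.2 fun i _ =>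
      hG.eventually_setLIntegral_le hξ hb i (ε := ENNReal.ofReal ((1 / 2) ^ k))
        (by rw [Ne, ENNReal.ofReal_eq_zero, not_le]; positivity)
    obtain ⟨α, h1, h2⟩ := ((eventually_ge_atTop k).and hall).exists
    exact ⟨α, h1, h2⟩
  choose α hαge hαtail using hα
  have hν : ∀ k : ℕ, ∃ n, k < n ∧ (∀ c ≤ k, |m n c - h c| ≤ (1 / 2) ^ k) ∧
      |m n (α k) - h (α k)| ≤ (1 / 2) ^ k ∧ ∀ c ≤ k, ∀ i ≤ k,
        |∫ ω, (trunc c (ξ i) ω - ζ c ω) * (trunc c (ξ n) ω - ζ c ω) ∂P| ≤ (1 / 2) ^ k := by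
    intro k
    have hpos : (0 : ℝ) < (1 / 2) ^ k := by positivity
    have hclose : ∀ c, ∀ᶠ n in (U : Filter ℕ), |m n c - h c| ≤ (1 / 2) ^ k := fun c => by
      filter_upwards [(hh c).eventually (Metric.closedBall_mem_nhds _ hpos)] with n hn
      simpa [Real.dist_eq] using hn
    have horth : ∀ c i : ℕ, ∀ᶠ n in (U : Filter ℕ),
        |∫ ω, (trunc c (ξ i) ω - ζ c ω) * (trunc c (ξ n) ω - ζ c ω) ∂P| ≤ (1 / 2) ^ k :=
      fun c i => by
        filter_upwards [(hζlim c i).eventually (Metric.closedBall_mem_nhds _ hpos)] with n hn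
        simpa [Real.dist_eq] using hn
    have h1 := (Set.finite_Iic k).eventually_all.2 fun c _ => hclose c
    have h2 := (Set.finite_Iic k).eventually_all.2 fun c _ =>
      (Set.finite_Iic k).eventually_all.2 fun i _ => horth c i
    obtain ⟨n, ha, hb, hc, hd⟩ := ((eventually_gt_atTop k).filter_mono
      Nat.hyperfilter_le_atTop |>.and (h1.and ((hclose (α k)).and h2))).exists
    exact ⟨n, ha, hb, hc, hd⟩
  choose ν hνgt hνm hνα hνorth using hν
  set p : ℕ → ℕ := fun k => ν^[k] 0 with hp
  have hpsucc : ∀ k, p (k + 1) = ν (p k) := fun k => Function.iterate_succ_apply' ν k 0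
  have hpmono : StrictMono p := strictMono_nat_of_lt_succ fun k => by
    rw [hpsucc]; exact hνgt _
  have hpge : ∀ k, k ≤ p k := fun k => hpmono.le_apply
  have hpow : ∀ k, (1 / 2 : ℝ) ^ p k ≤ (1 / 2) ^ k := fun k =>
    pow_le_pow_of_le_one (by norm_num) (by norm_num) (hpge k)
  have hpowc : ∀ {c k : ℕ}, k ≤ c → (1 : ℝ) ≤ 2 ^ c * (1 / 2) ^ k := fun {c k} hkc => by
    rw [one_div, inv_pow, ← div_eq_mul_inv, one_le_div (by positivity)]
    exact pow_le_pow_right₀ (by norm_num) hkc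
  set δ : ℕ → ℝ := fun c => (⨆ d, h d) - h c with hδ
  set K : ℕ → ℝ := fun c => 2 + (C + ((c : ℝ) + c) * (c + c)) * 2 ^ c with hK
  have hδ0 : ∀ c, 0 ≤ δ c := fun c => sub_nonneg.2 (le_ciSup hhbdd c)
  have hKC : ∀ c, C * 2 ^ c ≤ K c := fun c => by
    have : (0 : ℝ) ≤ ((c : ℝ) + c) * (c + c) * 2 ^ c := by positivity
    simp only [hK]; linarith
  have hK2 : ∀ c, 2 ≤ K c := fun c => by
    have : (0 : ℝ) ≤ (C + ((c : ℝ) + c) * (c + c)) * 2 ^ c := by positivity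
    simp only [hK]; linarith
  have hKc : ∀ c : ℕ, ((c : ℝ) + c) * (c + c) * 2 ^ c ≤ K c := fun c => by
    have : (0 : ℝ) ≤ C * 2 ^ c := by positivity
    simp only [hK]; linarith
  refine ⟨fun k => p (k + 1), δ, K, ζ, fun k => α (p k), fun i j hij => hpmono (by omega), hδ0,
    ?_, fun c => by linarith [hK2 c], hζm, hζb, fun k => hξ _, fun k => hb _, fun k => ?_,
    fun i j hij => ?_, fun c k => ?_, fun c i j hij => ?_⟩
  · simpa [hδ] using hhlim.const_sub (⨆ d, h d)
  · exact_mod_cast (hpge k).trans (hαge _)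
  · exact (hαtail (p j) (p (i + 1)) (hpmono.monotone hij) _).trans
      (ENNReal.ofReal_le_ofReal (hpow j))
  · simp only [Function.comp_apply]
    rcases le_or_gt c (p k) with hck | hck
    · have hcα : c ≤ α (p k) := hck.trans (hαge _)
      have hadd := hG.modular_middle_add (P := P) (Nat.cast_le (α := ℝ).2 hcα) (hξ (p (k + 1)))
      rw [ENNReal.le_ofReal_iff_toReal_le (hfin _ _)
        (add_nonneg (hδ0 c) (mul_nonneg (by linarith [hK2 c]) (by positivity)))]
      have hreal := congrArg ENNReal.toReal hadd
      have hfc : modular P G (trunc c (ξ (p (k + 1)))) ≠ ⊤ := hfin _ _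
      rw [ENNReal.toReal_add (hfin _ _) hfc] at hreal
      have h1 := (_root_.abs_le.1 (hνm (p k) c hck)).1
      have h2 := (_root_.abs_le.1 (hνα (p k))).2
      rw [← hpsucc] at h1 h2
      have h3 : h (α (p k)) ≤ ⨆ d, h d := le_ciSup hhbdd _
      have h4 := mul_le_mul_of_nonneg_right (hK2 c) (by positivity : (0 : ℝ) ≤ (1 / 2) ^ k)
      have h5 := hpow k
      simp only [hm] at h1 h2
      simp only [hδ]
      linarith
    · refine ((hG.modular_indicator_le _ _).trans (hb _)).trans (ENNReal.ofReal_le_ofReal ?_)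
      have h1 := mul_le_mul_of_nonneg_left (hpowc ((hpge k).trans hck.le)) hC
      have h2 := mul_le_mul_of_nonneg_right (hKC c) (by positivity : (0 : ℝ) ≤ (1 / 2) ^ k)
      have h3 := hδ0 c
      linarith
  · simp only [Function.comp_apply]
    rcases le_or_gt c (p j) with hcj | hcj
    · have h1 := hνorth (p j) c hcj (p (i + 1)) (hpmono.monotone hij)
      rw [← hpsucc] at h1
      refine h1.trans ((hpow j).trans (le_mul_of_one_le_left (by positivity) ?_))
      linarith [hK2 c]
    · have hbd : ∀ n ω, |trunc c (ξ n) ω - ζ c ω| ≤ (c : ℝ) + c := fun n ω =>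
        (abs_sub _ _).trans (add_le_add (abs_trunc_le c.cast_nonneg _ ω) (hζb c ω))
      have h1 : |∫ ω, (trunc c (ξ (p (i + 1))) ω - ζ c ω) *
          (trunc c (ξ (p (j + 1))) ω - ζ c ω) ∂P| ≤ ((c : ℝ) + c) * (c + c) := by
        have := norm_integral_le_of_norm_le_const (μ := P) (C := ((c : ℝ) + c) * (c + c))
          (f := fun ω => (trunc c (ξ (p (i + 1))) ω - ζ c ω) *
            (trunc c (ξ (p (j + 1))) ω - ζ c ω))
          (Eventually.of_forall fun ω => by
            rw [Real.norm_eq_abs, abs_mul]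
            exact mul_le_mul (hbd _ ω) (hbd _ ω) (abs_nonneg _) (by positivity))
        simpa using this
      refine h1.trans ?_
      have h2 := mul_le_mul_of_nonneg_left (hpowc ((hpge j).trans hcj.le))
        (by positivity : (0 : ℝ) ≤ ((c : ℝ) + c) * (c + c))
      have h3 := mul_le_mul_of_nonneg_right (hKc c) (by positivity : (0 : ℝ) ≤ (1 / 2) ^ j)
      linarith

end Extraction

section Limits

variable {Ω : Type*} [MeasurableSpace Ω] {P : Measure Ω} {G : ℝ → ℝ}

lemma IsGauge.modular_half_add_le (hG : IsGauge G) {f g : Ω → ℝ} (hf : Measurable f) :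
    modular P G (fun ω => (f ω + g ω) / 2) ≤ modular P G f + modular P G g := by
  have hfm : Measurable fun ω => ENNReal.ofReal (G (f ω)) := (hG.measurable.comp hf).ennreal_ofReal
  unfold modular
  rw [← lintegral_add_left hfm]
  refine lintegral_mono fun ω => ?_
  rw [← ENNReal.ofReal_add (hG.nonneg _) (hG.nonneg _)]
  exact ENNReal.ofReal_le_ofReal (hG.half_add_le _ _)

lemma IsGauge.modular_mono (hG : IsGauge G) {f g : Ω → ℝ} (h : ∀ ω, |f ω| ≤ |g ω|) :
    modular P G f ≤ modular P G g :=
  lintegral_mono fun ω => ENNReal.ofReal_le_ofReal (hG.mono (h ω))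

lemma IsGauge.lintegral_tsum_lt_top (hG : IsGauge G) {g : ℕ → Ω → ℝ}
    (hg : ∀ l, Measurable (g l))
    (hb : ∀ l, modular P G (g l) ≤ ENNReal.ofReal ((1 / 2) ^ l)) :
    ∫⁻ ω, ∑' l, ENNReal.ofReal (G (g l ω)) ∂P < ⊤ := by
  have hgm : ∀ l, Measurable fun ω => ENNReal.ofReal (G (g l ω)) := fun l =>
    (hG.measurable.comp (hg l)).ennreal_ofReal
  rw [lintegral_tsum fun l => (hgm l).aemeasurable]
  refine (ENNReal.tsum_le_tsum hb).trans_lt ?_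
  rw [← ENNReal.ofReal_tsum_of_nonneg (fun l => by positivity) summable_geometric_two]
  exact ENNReal.ofReal_lt_top

lemma IsGauge.summable_abs_of_tsum_ne_top (hG : IsGauge G) {x : ℕ → ℝ}
    (hx : ∑' l, ENNReal.ofReal (G (x l)) ≠ ⊤) : Summable fun l => |x l| := by
  refine Summable.of_nonneg_of_le (fun _ => abs_nonneg _) (fun l => hG.abs_le (x l)) ?_
  refine (ENNReal.summable_toReal hx).congr fun l => ?_
  rw [ENNReal.toReal_ofReal (hG.nonneg _)]

/-- A sequence that is Cauchy for the modular has a limit. -/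
lemma IsGauge.exists_modular_limit (hG : IsGauge G) {ζ : ℕ → Ω → ℝ}
    (hζ : ∀ c, Measurable (ζ c)) {δ : ℕ → ℝ} (hδ : Tendsto δ atTop (𝓝 0))
    (hcauchy : ∀ c d, modular P G (fun ω => (ζ c ω - ζ d ω) / 8) ≤ ENNReal.ofReal (δ c + δ d)) :
    ∃ ξ₀ : Ω → ℝ, Measurable ξ₀ ∧
      ∀ c, modular P G (fun ω => (ζ c ω - ξ₀ ω) / 8) ≤ ENNReal.ofReal (δ c) := by
  obtain ⟨φ, hφ, hφδ⟩ := extraction_forall_of_eventually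
    (P := fun l c => δ c ≤ (1 / 2) ^ (l + 1))
    fun l => hδ.eventually_le_const (by positivity)
  have hsum := hG.lintegral_tsum_lt_top (P := P)
    (g := fun l ω => (ζ (φ l) ω - ζ (φ (l + 1)) ω) / 8)
    (fun l => ((hζ _).sub (hζ _)).div_const 8) fun l =>
      (hcauchy _ _).trans (ENNReal.ofReal_le_ofReal (by
        have h1 := hφδ l
        have h2 := hφδ (l + 1)
        rw [pow_succ] at h1 h2
        rw [pow_succ] at h2
        have : (0 : ℝ) ≤ (1 / 2) ^ l := by positivity
        linarith))
  have hlim : ∀ᵐ ω ∂P, ∃ x, Tendsto (fun l => ζ (φ l) ω) atTop (𝓝 x) := by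
    filter_upwards [ae_lt_top (Measurable.tsum fun l =>
      (hG.measurable.comp (((hζ (φ l)).sub (hζ (φ (l + 1)))).div_const 8)).ennreal_ofReal)
      hsum.ne] with ω hω
    refine cauchySeq_tendsto_of_complete (cauchySeq_of_summable_dist ?_)
    refine ((hG.summable_abs_of_tsum_ne_top hω.ne).mul_left 8).congr fun l => ?_
    rw [Real.dist_eq, abs_div, abs_of_pos (by norm_num : (0 : ℝ) < 8)]
    simp only [Pi.sub_apply]
    ring
  obtain ⟨ξ₀, hξ₀, hξ₀lim⟩ :=
    measurable_limit_of_tendsto_metrizable_ae (L := atTop) (fun l => (hζ (φ l)).aemeasurable) hlim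
  refine ⟨ξ₀, hξ₀, fun c => ?_⟩
  have hae : ∀ᵐ ω ∂P, ENNReal.ofReal (G ((ζ c ω - ξ₀ ω) / 8)) =
      liminf (fun l => ENNReal.ofReal (G ((ζ c ω - ζ (φ l) ω) / 8))) atTop := by
    filter_upwards [hξ₀lim] with ω hω
    refine (Tendsto.liminf_eq ?_).symm
    exact (ENNReal.continuous_ofReal.tendsto _).comp ((hG.continuous.tendsto _).comp
      ((hω.const_sub _).div_const 8))
  have htend : Tendsto (fun l => ENNReal.ofReal (δ c + δ (φ l))) atTop
      (𝓝 (ENNReal.ofReal (δ c))) := by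
    have := (hδ.comp hφ.tendsto_atTop).const_add (δ c)
    rw [add_zero] at this
    exact (ENNReal.continuous_ofReal.tendsto _).comp this
  calc modular P G (fun ω => (ζ c ω - ξ₀ ω) / 8)
      = ∫⁻ ω, liminf (fun l => ENNReal.ofReal (G ((ζ c ω - ζ (φ l) ω) / 8))) atTop ∂P :=
        lintegral_congr_ae hae
    _ ≤ liminf (fun l => modular P G (fun ω => (ζ c ω - ζ (φ l) ω) / 8)) atTop :=
        lintegral_liminf_le fun l =>
          (hG.measurable.comp (((hζ c).sub (hζ (φ l))).div_const 8)).ennreal_ofReal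
    _ ≤ liminf (fun l => ENNReal.ofReal (δ c + δ (φ l))) atTop :=
        liminf_le_liminf (Eventually.of_forall fun l => hcauchy _ _)
    _ = ENNReal.ofReal (δ c) := htend.liminf_eq

/-- The Cesàro means of all subsequences of a split sequence converge in modular to one limit. -/
lemma IsSplit.exists_modular_limit [IsProbabilityMeasure P] (hG : IsGauge G) {C : ℝ}
    {δ K : ℕ → ℝ} {ζ : ℕ → Ω → ℝ} {a : ℕ → ℝ} {f : ℕ → Ω → ℝ} (hC : 0 ≤ C)
    (hδ0 : ∀ c, 0 ≤ δ c) (hδ : Tendsto δ atTop (𝓝 0)) (hK : ∀ c, 0 ≤ K c)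
    (hζ : ∀ c, Measurable (ζ c)) (hζb : ∀ c ω, |ζ c ω| ≤ c) (h : IsSplit P G C δ K ζ a f) :
    ∃ ξ₀ : Ω → ℝ, Measurable ξ₀ ∧ modular P G (fun ω => ξ₀ ω / 16) < ⊤ ∧
      ∀ k : ℕ → ℕ, StrictMono k → ∀ ε : ℝ, 0 < ε → ∀ᶠ N in atTop,
        modular P G (fun ω => (cesaro (f ∘ k) N ω - ξ₀ ω) / 16) ≤ ENNReal.ofReal ε := by
  have hcauchy : ∀ c d,
      modular P G (fun ω => (ζ c ω - ζ d ω) / 8) ≤ ENNReal.ofReal (δ c + δ d) := by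
    intro c d
    refine ENNReal.le_of_forall_pos_le_add fun ε hε _ => ?_
    have hε2 : (0 : ℝ) < ε / 2 := by positivity
    obtain ⟨N, h1, h2⟩ := ((h.modular_cesaro_sub_le hG hC hδ0 hK hζ hζb c hε2).and
      (h.modular_cesaro_sub_le hG hC hδ0 hK hζ hζb d hε2)).exists
    have hN := measurable_cesaro h.meas N
    have h3 : modular P G (fun ω => (ζ c ω - ζ d ω) / 8) ≤
        modular P G (fun ω => (cesaro f N ω - ζ d ω) / 4) +
          modular P G (fun ω => (ζ c ω - cesaro f N ω) / 4) := by
      refine le_of_eq_of_le ?_ (hG.modular_half_add_le ((hN.sub (hζ d)).div_const 4))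
      congr 1
      funext ω
      ring
    have h4 : modular P G (fun ω => (ζ c ω - cesaro f N ω) / 4) ≤
        modular P G (fun ω => (cesaro f N ω - ζ c ω) / 4) :=
      hG.modular_mono fun ω => by rw [abs_div, abs_div, abs_sub_comm]
    refine (h3.trans (add_le_add h2 (h4.trans h1))).trans ?_
    have hc := hδ0 c
    have hd := hδ0 d
    rw [← ENNReal.ofReal_add (by positivity) (by positivity), ← ENNReal.ofReal_coe_nnreal,
      ← ENNReal.ofReal_add (by positivity) (by positivity)]
    exact ENNReal.ofReal_le_ofReal (by linarith)
  obtain ⟨ξ₀, hξ₀, hlim⟩ := hG.exists_modular_limit hζ hδ hcauchy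
  refine ⟨ξ₀, hξ₀, ?_, fun k hk ε hε => ?_⟩
  · have h1 : modular P G (fun ω => ξ₀ ω / 16) ≤
        modular P G (fun ω => ζ 0 ω / 8) + modular P G (fun ω => (ζ 0 ω - ξ₀ ω) / 8) := by
      refine le_trans (hG.modular_mono fun ω => ?_)
        (hG.modular_half_add_le (f := fun ω => -((fun ω => ζ 0 ω / 8) ω))
          ((hζ 0).div_const 8).neg |>.trans (add_le_add_left (hG.modular_mono fun ω => ?_) _))
      · rw [← abs_neg]
        refine le_of_eq (congrArg _ ?_)
        ring
      · rw [abs_neg]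
    refine h1.trans_lt (ENNReal.add_lt_top.2 ⟨?_, (hlim 0).trans_lt ENNReal.ofReal_lt_top⟩)
    have h0 : ∀ ω, ζ 0 ω = 0 := fun ω => by simpa using hζb 0 ω
    simp [modular, h0, hG.map_zero]
  · obtain ⟨c, hc⟩ := (hδ.eventually_le_const (by positivity : (0 : ℝ) < ε / 3)).exists
    filter_upwards [(h.comp hK hk).modular_cesaro_sub_le hG hC hδ0 hK hζ hζb c
      (by positivity : (0 : ℝ) < ε / 3)] with N hN
    have hNm := measurable_cesaro (h.comp hK hk).meas N
    have h1 : modular P G (fun ω => (cesaro (f ∘ k) N ω - ξ₀ ω) / 16) ≤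
        modular P G (fun ω => (cesaro (f ∘ k) N ω - ζ c ω) / 8) +
          modular P G (fun ω => (ζ c ω - ξ₀ ω) / 8) := by
      refine le_of_eq_of_le ?_ (hG.modular_half_add_le ((hNm.sub (hζ c)).div_const 8))
      congr 1
      funext ω
      ring
    have h2 : modular P G (fun ω => (cesaro (f ∘ k) N ω - ζ c ω) / 8) ≤
        modular P G (fun ω => (cesaro (f ∘ k) N ω - ζ c ω) / 4) :=
      hG.modular_mono fun ω => by
        rw [abs_div, abs_div, abs_of_pos (by norm_num : (0 : ℝ) < 8),
          abs_of_pos (by norm_num : (0 : ℝ) < 4)]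
        have := abs_nonneg (cesaro (f ∘ k) N ω - ζ c ω)
        linarith
    refine (h1.trans (add_le_add (h2.trans hN) (hlim c))).trans ?_
    have hc0 := hδ0 c
    rw [← ENNReal.ofReal_add (by positivity) (by positivity)]
    exact ENNReal.ofReal_le_ofReal (by linarith)

/-- A rapidly modular-convergent sequence converges almost surely and is order bounded. -/
lemma IsGauge.order_convergence (hG : IsGauge G) {f : ℕ → Ω → ℝ} {ξ₀ : Ω → ℝ}
    (hf : ∀ l, Measurable (f l)) (hξ₀ : Measurable ξ₀)
    (hfin : modular P G (fun ω => ξ₀ ω / 16) < ⊤)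
    (hb : ∀ l, modular P G (fun ω => (f l ω - ξ₀ ω) / 16) ≤ ENNReal.ofReal ((1 / 2) ^ l)) :
    (∀ᵐ ω ∂P, Tendsto (fun l => f l ω) atTop (𝓝 (ξ₀ ω))) ∧
      (∀ᵐ ω ∂P, BddAbove (range fun l => |f l ω|)) ∧
      modular P G (fun ω => (⨆ l, |f l ω|) / 32) < ⊤ := by
  have hdm : ∀ l, Measurable fun ω => (f l ω - ξ₀ ω) / 16 := fun l =>
    ((hf l).sub hξ₀).div_const 16
  have hsm : ∀ l, Measurable fun ω => ENNReal.ofReal (G ((f l ω - ξ₀ ω) / 16)) := fun l =>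
    (hG.measurable.comp (hdm l)).ennreal_ofReal
  have hsum := hG.lintegral_tsum_lt_top hdm hb
  have hae := ae_lt_top (Measurable.tsum hsm) hsum.ne
  have hlim : ∀ᵐ ω ∂P, Tendsto (fun l => f l ω) atTop (𝓝 (ξ₀ ω)) := by
    filter_upwards [hae] with ω hω
    have h1 := (hG.summable_abs_of_tsum_ne_top hω.ne).tendsto_atTop_zero
    have h2 := ((tendsto_zero_iff_abs_tendsto_zero _).2 h1).const_mul 16
    refine tendsto_sub_nhds_zero_iff.1 ?_
    rw [mul_zero] at h2
    refine h2.congr fun l => ?_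
    ring
  have hbdd : ∀ᵐ ω ∂P, BddAbove (range fun l => |f l ω|) := by
    filter_upwards [hlim] with ω hω
    exact hω.abs.bddAbove_range
  refine ⟨hlim, hbdd, ?_⟩
  have hle : ∀ᵐ ω ∂P, ENNReal.ofReal (G ((⨆ l, |f l ω|) / 32)) ≤
      ENNReal.ofReal (G (ξ₀ ω / 16)) +
        ∑' l, ENNReal.ofReal (G ((f l ω - ξ₀ ω) / 16)) := by
    filter_upwards [hbdd] with ω hω
    obtain ⟨u, -, -, hu, hmem⟩ := (isLUB_ciSup hω).exists_seq_monotone_tendsto (range_nonempty _)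
    refine le_of_tendsto ((ENNReal.continuous_ofReal.tendsto _).comp
      ((hG.continuous.tendsto _).comp (hu.div_const 32))) (Eventually.of_forall fun i => ?_)
    obtain ⟨l, hl⟩ := hmem i
    simp only [Function.comp_apply, ← hl]
    refine le_trans ?_ (add_le_add_right (ENNReal.le_tsum l) _)
    rw [← ENNReal.ofReal_add (hG.nonneg _) (hG.nonneg _)]
    refine ENNReal.ofReal_le_ofReal (le_trans (hG.mono (le_of_eq ?_)) (hG.half_add_le _ _))
    rw [show (ξ₀ ω / 16 + (f l ω - ξ₀ ω) / 16) / 2 = f l ω / 32 by ring, abs_div, abs_div, abs_abs]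
  refine (lintegral_mono_ae hle).trans_lt ?_
  rw [lintegral_add_right _ (Measurable.tsum hsm)]
  exact ENNReal.add_lt_top.2 ⟨hfin, hsum⟩

end Limits

section Luxemburg

variable {Ω : Type*} [MeasurableSpace Ω] {P : Measure Ω} {Φ : ℝ → ℝ}

/-- Functions in the Orlicz space have modular at most one after division by any number above
the Luxemburg norm. -/
lemma IsYoung.lintegral_conj_le_one (h : IsYoung Φ) {f : Ω → ℝ} (hf : MemOrlicz P (conj Φ) f)
    {r : ℝ} (hr : luxNorm P (conj Φ) f < r) :
    ∫⁻ ω, ENNReal.ofReal (conj Φ (f ω / r)) ∂P ≤ 1 := by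
  have hne : {l : ℝ | 0 < l ∧
      ∫⁻ ω, ENNReal.ofReal (conj Φ (f ω / l)) ∂P ≤ 1}.Nonempty := by
    obtain ⟨hfm, l, hl, hfin⟩ := hf
    set I := ∫⁻ ω, ENNReal.ofReal (conj Φ (l * f ω)) ∂P
    set t : ℝ := (I.toReal + 1)⁻¹ with ht
    have hI0 : 0 ≤ I.toReal := ENNReal.toReal_nonneg
    have htpos : 0 < t := by positivity
    have ht1 : t ≤ 1 := inv_le_one_of_one_le₀ (by linarith)
    refine ⟨(t * l)⁻¹, by positivity, ?_⟩
    calc ∫⁻ ω, ENNReal.ofReal (conj Φ (f ω / (t * l)⁻¹)) ∂P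
        ≤ ∫⁻ ω, ENNReal.ofReal t * ENNReal.ofReal (conj Φ (l * f ω)) ∂P := by
          refine lintegral_mono fun ω => ?_
          rw [← ENNReal.ofReal_mul htpos.le, div_inv_eq_mul,
            show f ω * (t * l) = t * (l * f ω) by ring]
          exact ENNReal.ofReal_le_ofReal
            (convex_smul_le h.conj_convexOn h.conj_zero htpos.le ht1 _)
      _ = ENNReal.ofReal t * I := lintegral_const_mul' _ _ ENNReal.ofReal_ne_top
      _ = ENNReal.ofReal (t * I.toReal) := by
          rw [ENNReal.ofReal_mul htpos.le, ENNReal.ofReal_toReal hfin.ne]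
      _ ≤ 1 := by
          rw [ENNReal.ofReal_le_one, ht, inv_mul_le_one₀ (by positivity)]
          linarith
  obtain ⟨l, ⟨hl, hl1⟩, hlr⟩ := exists_lt_of_csInf_lt hne hr
  refine (lintegral_mono fun ω => ENNReal.ofReal_le_ofReal ?_).trans hl1
  refine even_convex_mono h.conj_even h.conj_convexOn h.conj_zero ?_
  rw [abs_div, abs_div, abs_of_pos hl, abs_of_pos (hl.trans hlr)]
  exact div_le_div_of_nonneg_left (abs_nonneg _) hl hlr.le

lemma IsYoung.modular_conj_add_abs_le [IsProbabilityMeasure P] (h : IsYoung Φ) {f : Ω → ℝ}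
    {r : ℝ} (hr : 0 < r) (hf : ∫⁻ ω, ENNReal.ofReal (conj Φ (f ω / r)) ∂P ≤ 1) :
    modular P (fun y => conj Φ (y / r) + |y|) f ≤ ENNReal.ofReal (1 + r + r * Φ 1) := by
  have hΦ1 := h.nonneg 1
  have hle : ∀ y, conj Φ (y / r) + |y| ≤ (1 + r) * conj Φ (y / r) + r * Φ 1 := fun y => by
    have h1 := mul_le_mul_of_nonneg_left (h.le_conj 1 |y / r|) hr.le
    rw [h.conj_abs, abs_div, abs_of_pos hr, one_mul, mul_sub, mul_div_cancel₀ _ hr.ne'] at h1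
    linarith
  calc modular P (fun y => conj Φ (y / r) + |y|) f
      ≤ ∫⁻ ω, (ENNReal.ofReal (1 + r) * ENNReal.ofReal (conj Φ (f ω / r)) +
          ENNReal.ofReal (r * Φ 1)) ∂P := by
        refine lintegral_mono fun ω => ?_
        rw [← ENNReal.ofReal_mul (by positivity), ← ENNReal.ofReal_add
          (mul_nonneg (by positivity) (h.conj_nonneg _)) (by positivity)]
        exact ENNReal.ofReal_le_ofReal (hle _)
    _ = ENNReal.ofReal (1 + r) * ∫⁻ ω, ENNReal.ofReal (conj Φ (f ω / r)) ∂P +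
          ENNReal.ofReal (r * Φ 1) := by
        rw [lintegral_add_right _ measurable_const,
          lintegral_const_mul' _ _ ENNReal.ofReal_ne_top]
        simp
    _ ≤ ENNReal.ofReal (1 + r) * 1 + ENNReal.ofReal (r * Φ 1) := by gcongr
    _ = ENNReal.ofReal (1 + r + r * Φ 1) := by
        rw [mul_one, ← ENNReal.ofReal_add (by positivity) (by positivity)]

lemma memOrlicz_conj_of_modular_lt_top {f : Ω → ℝ} (hf : Measurable f) {r s : ℝ} (hr : 0 < r)
    (hs : 0 < s) (h : modular P (fun y => conj Φ (y / r) + |y|) (fun ω => f ω / s) < ⊤) :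
    MemOrlicz P (conj Φ) f := by
  refine ⟨hf, (s * r)⁻¹, by positivity, lt_of_le_of_lt (lintegral_mono fun ω => ?_) h⟩
  refine ENNReal.ofReal_le_ofReal ?_
  simp only [div_div, inv_mul_eq_div]
  exact le_add_of_nonneg_right (abs_nonneg _)

end Luxemburg

/-- Komlós-type theorem, second version. If `Φ ∈ Δ₂`, every
norm-bounded sequence `(ξ_n)` in `L_{Φ*}` has a subsequence `(ξ_{n_k})` and a
limit `ξ ∈ L_{Φ*}` such that for every further subsequence, the Cesàro means
admit a subsequence converging in order to `ξ`. -/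
theorem statement9
    {Ω : Type*} [MeasurableSpace Ω] (P : Measure Ω) [IsProbabilityMeasure P]
    (Φ : ℝ → ℝ) (hΦ : IsYoung Φ) (hΔ : Delta2 Φ)
    (ξ : ℕ → Ω → ℝ) (hmem : ∀ n, MemOrlicz P (conj Φ) (ξ n))
    (hbdd : ∃ M : ℝ, ∀ n, luxNorm P (conj Φ) (ξ n) ≤ M) :
    ∃ n : ℕ → ℕ, StrictMono n ∧ ∃ ξ₀ : Ω → ℝ, MemOrlicz P (conj Φ) ξ₀ ∧
      ∀ k : ℕ → ℕ, StrictMono k →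
        ∃ L : ℕ → ℕ, StrictMono L ∧
          supMem P (conj Φ) (fun l => cesaro (fun i => ξ (n (k i))) (L l)) ∧
          ∀ᵐ ω ∂P,
            Tendsto (fun l => cesaro (fun i => ξ (n (k i))) (L l) ω) atTop (𝓝 (ξ₀ ω)) := by
  obtain ⟨M, hM⟩ := hbdd
  set r := |M| + 1
  have hr : 0 < r := by positivity
  have hΦ1 := hΦ.nonneg 1
  have hG := hΦ.isGauge_conj hΔ hr
  have hC : 0 ≤ 1 + r + r * Φ 1 := by positivity
  have hb := fun n => hΦ.modular_conj_add_abs_le hr (hΦ.lintegral_conj_le_one (hmem n)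
    (lt_of_le_of_lt (hM n) (lt_of_le_of_lt (le_abs_self M) (lt_add_one |M|))))
  obtain ⟨n, δ, K, ζ, a, hn, hδ0, hδ, hK, hζ, hζb, hsplit⟩ :=
    hG.exists_isSplit hC (fun n => (hmem n).1) hb
  obtain ⟨ξ₀, hξ₀, hfin, hlim⟩ := hsplit.exists_modular_limit hG hC hδ0 hδ hK hζ hζb
  refine ⟨n, hn, ξ₀, memOrlicz_conj_of_modular_lt_top hξ₀ hr (by norm_num) hfin,
    fun k hk => ?_⟩
  obtain ⟨L, hL, hLb⟩ := extraction_forall_of_eventually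
    fun l : ℕ => hlim k hk ((1 / 2) ^ l) (by positivity)
  have hm : ∀ l, Measurable (cesaro (fun i => ξ (n (k i))) (L l)) := fun l =>
    measurable_cesaro (fun i => (hmem _).1) _
  obtain ⟨h1, h2, h3⟩ := hG.order_convergence hm hξ₀ hfin hLb
  exact ⟨L, hL, ⟨h2, memOrlicz_conj_of_modular_lt_top (Measurable.iSup fun l => (hm l).abs) hr
    (by norm_num) h3⟩, h1⟩

end OrliczPaper
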